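/- arXiv:2308.08768 — 7 statements merged into one kernel-verified Lean document; each statement's English description precedes it below -/
import Mathlib

section
/- Let G be a finite simple graph that is (P3∪P2)-free, W4-free, K5-free, 2K3-free and (P2∪K4)-free. If G contains an induced subgraph isomorphic to P2∪K3 (the disjoint union of an edge and a triangle), then χ(G) ≤ 8. -/
open SimpleGraph

/-- `P3 ∪ P2`: disjoint union of a path on 3 vertices (0-1-2) and an edge (3-4). -/
def P3P2 : SimpleGraph (Fin 5) :=
  SimpleGraph.fromEdgeSet {s(0,1), s(1,2), s(3,4)}

/-- `W4`: wheel on 5 vertices; 4-cycle 0-1-2-3-0 plus hub 4 adjacent to all. -/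
def W4 : SimpleGraph (Fin 5) :=
  SimpleGraph.fromEdgeSet {s(0,1), s(1,2), s(2,3), s(3,0), s(4,0), s(4,1), s(4,2), s(4,3)}

/-- `2K3`: disjoint union of two triangles (0,1,2) and (3,4,5). -/
def twoK3 : SimpleGraph (Fin 6) :=
  SimpleGraph.fromEdgeSet {s(0,1), s(1,2), s(0,2), s(3,4), s(4,5), s(3,5)}

/-- `P2 ∪ K4`: disjoint union of an edge (0-1) and a complete graph on {2,3,4,5}. -/
def P2K4 : SimpleGraph (Fin 6) :=
  SimpleGraph.fromEdgeSet {s(0,1), s(2,3), s(2,4), s(2,5), s(3,4), s(3,5), s(4,5)}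

/-- `P2 ∪ K3`: disjoint union of an edge (0-1) and a triangle (2,3,4). -/
def P2K3 : SimpleGraph (Fin 5) :=
  SimpleGraph.fromEdgeSet {s(0,1), s(2,3), s(3,4), s(2,4)}

namespace Stmt7

variable {V : Type*}

/-- `X` can be properly coloured with `k` colours. -/
def ColOn (G : SimpleGraph V) (X : V → Prop) (k : ℕ) : Prop :=
  ∃ c : V → ℕ, (∀ v, X v → c v < k) ∧ ∀ v w, X v → X w → G.Adj v w → c v ≠ c w

lemma ColOn.add {G : SimpleGraph V} {X Y : V → Prop} {k l : ℕ}
    (hX : ColOn G X k) (hY : ColOn G Y l) : ColOn G (fun v => X v ∨ Y v) (k + l) := by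
  classical
  obtain ⟨c, hc, hc'⟩ := hX
  obtain ⟨d, hd, hd'⟩ := hY
  refine ⟨fun v => if X v then c v else k + d v, ?_, ?_⟩
  · intro v hv
    have := hc v
    have := hd v
    dsimp only
    split_ifs <;> grind
  · intro v w hv hw h
    have := hc v
    have := hc w
    have := hc' v w
    have := hd' v w
    dsimp only
    split_ifs <;> grind

lemma ColOn.union {G : SimpleGraph V} {X Y : V → Prop} {k : ℕ}
    (hX : ColOn G X k) (hY : ColOn G Y k) (h : ∀ v w, X v → Y w → ¬ G.Adj v w) :
    ColOn G (fun v => X v ∨ Y v) k := by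
  classical
  obtain ⟨c, hc, hc'⟩ := hX
  obtain ⟨d, hd, hd'⟩ := hY
  refine ⟨fun v => if X v then c v else d v, ?_, ?_⟩
  · intro v hv
    have := hc v
    have := hd v
    dsimp only
    split_ifs <;> grind
  · intro v w hv hw hvw
    have := h v w
    have := h w v
    have := hvw.symm
    have := hc' v w
    have := hd' v w
    dsimp only
    split_ifs <;> grind

lemma ColOn.mono {G : SimpleGraph V} {X Y : V → Prop} {k : ℕ}
    (hX : ColOn G X k) (h : ∀ v, Y v → X v) : ColOn G Y k := by
  obtain ⟨c, hc, hc'⟩ := hX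
  exact ⟨c, fun v hv => hc v (h v hv), fun v w hv hw => hc' v w (h v hv) (h w hw)⟩

lemma ColOn.one {G : SimpleGraph V} {X : V → Prop}
    (h : ∀ v w, X v → X w → ¬ G.Adj v w) : ColOn G X 1 :=
  ⟨fun _ => 0, fun _ _ => one_pos, fun v w hv hw hvw => absurd hvw (h v w hv hw)⟩

lemma ColOn.two {G : SimpleGraph V} {X : V → Prop}
    (h : ∀ v y z, X v → X y → X z → G.Adj v y → G.Adj v z → y = z) : ColOn G X 2 := by
  classical
  let _ : LinearOrder V := linearOrderOfSTO (WellOrderingRel (α := V))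
  refine ⟨fun v => if ∃ y, X y ∧ G.Adj v y ∧ y < v then 1 else 0, ?_, ?_⟩
  · intro v _
    dsimp only
    split_ifs <;> omega
  · have key : ∀ v w, X v → X w → G.Adj v w → v < w →
        (∃ y, X y ∧ G.Adj w y ∧ y < w) ∧ ¬ (∃ y, X y ∧ G.Adj v y ∧ y < v) := by
      intro v w hv hw hvw hlt
      refine ⟨⟨v, hv, hvw.symm, hlt⟩, ?_⟩
      rintro ⟨y, hy, hvy, hyv⟩
      have := h v w y hv hw hy hvw hvy
      subst this
      exact absurd hlt (not_lt.2 hyv.le)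
    intro v w hv hw hvw
    rcases lt_trichotomy v w with hlt | heq | hlt
    · obtain ⟨h1, h2⟩ := key v w hv hw hvw hlt
      dsimp only
      rw [if_pos h1, if_neg h2]; omega
    · exact absurd heq hvw.ne
    · obtain ⟨h1, h2⟩ := key w v hw hv hvw.symm hlt
      dsimp only
      rw [if_pos h1, if_neg h2]; omega

/-- A triangle-free, `C4`-free, `P3 ∪ P2`-free vertex set is 3-colourable. -/
lemma ColOn.three {G : SimpleGraph V} {X : V → Prop}
    (hP : ∀ p q r s t, p ≠ r → G.Adj p q → G.Adj q r → ¬ G.Adj p r → G.Adj s t →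
      ¬ G.Adj p s → ¬ G.Adj p t → ¬ G.Adj q s → ¬ G.Adj q t → ¬ G.Adj r s → ¬ G.Adj r t → False)
    (hT : ∀ x y z, X x → X y → X z → G.Adj x y → G.Adj y z → G.Adj x z → False)
    (hC : ∀ x y z w, X x → X y → X z → X w → x ≠ z → y ≠ w → G.Adj x y → G.Adj y z →
      G.Adj z w → G.Adj w x → ¬ G.Adj x z → ¬ G.Adj y w → False) : ColOn G X 3 := by
  by_cases hE : ∃ u v, X u ∧ X v ∧ G.Adj u v
  · obtain ⟨u, v, hu, hv, huv⟩ := hE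
    have h1 : ColOn G (fun x => X x ∧ x ≠ u ∧ x ≠ v ∧ (G.Adj x u ∨ G.Adj x v)) 1 := by
      apply ColOn.one
      rintro x y ⟨hx, hxu, hxv, hx'⟩ ⟨hy, hyu, hyv, hy'⟩ hxy
      have := huv.symm
      have := hxy.symm
      rcases hx' with hx' | hx' <;> rcases hy' with hy' | hy'
      · exact hT x y u hx hy hu hxy hy' hx'
      · exact hC x y v u hx hy hv hu hxv hyu hxy hy' huv.symm hx'.symm
          (fun h => hT x u v hx hu hv hx' huv h)
          (fun h => hT y u v hy hu hv h huv hy')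
      · exact hC x y u v hx hy hu hv hxu hyv hxy hy' huv hx'.symm
          (fun h => hT x u v hx hu hv h huv hx')
          (fun h => hT y u v hy hu hv hy' huv h)
      · exact hT x y v hx hy hv hxy hy' hx'
    have h2 : ColOn G (fun x => X x ∧ (x = u ∨ x = v ∨ (¬ G.Adj x u ∧ ¬ G.Adj x v))) 2 := by
      apply ColOn.two
      rintro x y z ⟨hx, hx'⟩ ⟨hy, hy'⟩ ⟨hz, hz'⟩ hxy hxz
      by_contra hne
      have hyz : ¬ G.Adj y z := fun h => hT x y z hx hy hz hxy h hxz
      have := hP y x z u v hne hxy.symm hxz hyz huv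
      have := G.irrefl (v := u)
      have := G.irrefl (v := v)
      have := G.adj_comm x y
      have := G.adj_comm x z
      have := G.adj_comm u v
      grind
    refine (h1.add h2).mono ?_
    intro x hx
    grind
  · refine (ColOn.one (G := G) (X := X) ?_).add (ColOn.one (G := G) (X := fun _ => False) ?_)
      |>.add (ColOn.one (G := G) (X := fun _ => False) ?_) |>.mono ?_
    · intro v w hv hw h
      exact hE ⟨v, w, hv, hw, h⟩
    all_goals simp

lemma core {G : SimpleGraph V}
    (hP : ∀ p q r s t, p ≠ r → G.Adj p q → G.Adj q r → ¬ G.Adj p r → G.Adj s t →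
      ¬ G.Adj p s → ¬ G.Adj p t → ¬ G.Adj q s → ¬ G.Adj q t → ¬ G.Adj r s → ¬ G.Adj r t → False)
    (hW : ∀ x y z w h, x ≠ z → y ≠ w → G.Adj x y → G.Adj y z →
      G.Adj z w → G.Adj w x → ¬ G.Adj x z → ¬ G.Adj y w →
      G.Adj h x → G.Adj h y → G.Adj h z → G.Adj h w → False)
    (hK : ∀ x y z w h, G.Adj x y → G.Adj x z → G.Adj x w → G.Adj x h → G.Adj y z → G.Adj y w →
      G.Adj y h → G.Adj z w → G.Adj z h → G.Adj w h → False)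
    (hTT : ∀ x y z p q r, G.Adj x y → G.Adj y z → G.Adj x z → G.Adj p q → G.Adj q r → G.Adj p r →
      ¬ G.Adj x p → ¬ G.Adj x q → ¬ G.Adj x r → ¬ G.Adj y p → ¬ G.Adj y q → ¬ G.Adj y r →
      ¬ G.Adj z p → ¬ G.Adj z q → ¬ G.Adj z r → False)
    (t₁ t₂ t₃ : V) (h12 : G.Adj t₁ t₂) (h13 : G.Adj t₁ t₃) (h23 : G.Adj t₂ t₃)
    (hB12 : ∀ x y, G.Adj x t₁ → ¬ G.Adj x t₂ → ¬ G.Adj x t₃ →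
      G.Adj y t₂ → ¬ G.Adj y t₁ → ¬ G.Adj y t₃ → ¬ G.Adj x y)
    (hB1 : ∀ x y, G.Adj x t₁ → ¬ G.Adj x t₂ → ¬ G.Adj x t₃ →
      G.Adj y t₁ → ¬ G.Adj y t₂ → ¬ G.Adj y t₃ → x = y)
    (hB2 : ∀ x y, G.Adj x t₂ → ¬ G.Adj x t₁ → ¬ G.Adj x t₃ →
      G.Adj y t₂ → ¬ G.Adj y t₁ → ¬ G.Adj y t₃ → x = y)
    (hB3 : ∀ x y, G.Adj x t₃ → ¬ G.Adj x t₁ → ¬ G.Adj x t₂ →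
      G.Adj y t₃ → ¬ G.Adj y t₁ → ¬ G.Adj y t₂ → x = y) :
    G.Colorable 8 := by
  have S1 : ColOn G (fun v => v = t₁ ∨ v = t₂ ∨
      (¬ G.Adj v t₁ ∧ ¬ G.Adj v t₂ ∧ ¬ G.Adj v t₃)) 2 := by
    apply ColOn.two
    intro x y z hx hy hz hxy hxz
    by_contra hne
    have h1 := hP y x z t₁ t₂ hne hxy.symm hxz
    have h2 := hTT x y z t₁ t₂ t₃ hxy
    have := G.irrefl (v := t₁)
    have := G.irrefl (v := t₂)
    have := G.adj_comm x y
    have := G.adj_comm x z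
    have := G.adj_comm t₁ t₂
    grind
  have key : ∀ p q r : V, G.Adj p q → ColOn G (fun v => G.Adj v p ∧ G.Adj v q ∧ ¬ G.Adj v r ∧ v ≠ r) 3 := by
    intro p q r hpq
    apply ColOn.three hP
    · rintro x y z ⟨hx, hx', -⟩ ⟨hy, hy', -⟩ ⟨hz, hz', -⟩ hxy hyz hxz
      exact hK p q x y z hpq hx.symm hy.symm hz.symm hx'.symm hy'.symm hz'.symm hxy hxz hyz
    · rintro x y z w ⟨hx, -⟩ ⟨hy, -⟩ ⟨hz, -⟩ ⟨hw, -⟩ h1 h2 h3 h4 h5 h6 h7 h8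
      exact hW x y z w p h1 h2 h3 h4 h5 h6 h7 h8 hx.symm hy.symm hz.symm hw.symm
  have anti : ∀ p q r : V, G.Adj p q → G.Adj p r → G.Adj q r → ∀ v w,
      G.Adj v p → G.Adj v q → ¬ G.Adj v r → v ≠ r → G.Adj w p → G.Adj w r → ¬ G.Adj w q → w ≠ q →
      ¬ G.Adj v w := by
    intro p q r hpq hpr hqr v w h1 h2 h3 h4 h5 h6 h7 h8 h
    exact hW v q r w p h4 h8.symm h2 hqr h6.symm h.symm h3 (fun h => h7 h.symm)
      h1.symm hpq hpr h5.symm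
  have S2 := ((key t₁ t₂ t₃ h12).union (key t₁ t₃ t₂ h13) (by
    rintro v w ⟨a1, a2, a3, a4⟩ ⟨b1, b2, b3, b4⟩
    exact anti t₁ t₂ t₃ h12 h13 h23 v w a1 a2 a3 a4 b1 b2 b3 b4)).union (key t₂ t₃ t₁ h23) (by
    rintro v w (⟨a1, a2, a3, a4⟩ | ⟨a1, a2, a3, a4⟩) ⟨b1, b2, b3, b4⟩
    · exact anti t₂ t₁ t₃ h12.symm h23 h13 v w a2 a1 a3 a4 b1 b2 b3 b4
    · exact anti t₃ t₁ t₂ h13.symm h23.symm h12 v w a2 a1 a3 a4 b2 b1 b3 b4)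
  have S3 : ColOn G (fun v => G.Adj v t₁ ∧ G.Adj v t₂ ∧ G.Adj v t₃) 1 := by
    apply ColOn.one
    rintro v w ⟨a1, a2, a3⟩ ⟨b1, b2, b3⟩ h
    exact hK v w t₁ t₂ t₃ h a1 a2 a3 b1 b2 b3 h12 h13 h23
  have S4 : ColOn G (fun v => v = t₃ ∨ (G.Adj v t₁ ∧ ¬ G.Adj v t₂ ∧ ¬ G.Adj v t₃) ∨
      (G.Adj v t₂ ∧ ¬ G.Adj v t₁ ∧ ¬ G.Adj v t₃)) 1 := by
    apply ColOn.one
    intro v w hv hw h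
    have := hB12 v w
    have := hB12 w v
    have := hB1 v w
    have := hB2 v w
    have := h.symm
    have := h.ne
    have := G.irrefl (v := t₃)
    grind
  have S5 : ColOn G (fun v => (G.Adj v t₃ ∧ ¬ G.Adj v t₁ ∧ ¬ G.Adj v t₂)) 1 := by
    apply ColOn.one
    rintro v w ⟨a1, a2, a3⟩ ⟨b1, b2, b3⟩ h
    exact h.ne (hB3 v w a1 a2 a3 b1 b2 b3)
  obtain ⟨c, hc, hc'⟩ := (((S1.add S2).add S3).add S4).add S5
  have hall : ∀ v, _ := fun v => hc v (by
    by_cases a1 : G.Adj v t₁ <;> by_cases a2 : G.Adj v t₂ <;> by_cases a3 : G.Adj v t₃ <;>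
      by_cases e1 : v = t₁ <;> by_cases e2 : v = t₂ <;> by_cases e3 : v = t₃ <;>
      simp [a1, a2, a3, e1, e2, e3])
  refine ⟨Coloring.mk (fun v => (⟨c v, hall v⟩ : Fin 8)) ?_⟩
  intro v w h heq
  refine hc' v w ?_ ?_ h (by simpa using heq)
  · by_cases a1 : G.Adj v t₁ <;> by_cases a2 : G.Adj v t₂ <;> by_cases a3 : G.Adj v t₃ <;>
      by_cases e1 : v = t₁ <;> by_cases e2 : v = t₂ <;> by_cases e3 : v = t₃ <;>
      simp [a1, a2, a3, e1, e2, e3]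
  · by_cases a1 : G.Adj w t₁ <;> by_cases a2 : G.Adj w t₂ <;> by_cases a3 : G.Adj w t₃ <;>
      by_cases e1 : w = t₁ <;> by_cases e2 : w = t₂ <;> by_cases e3 : w = t₃ <;>
      simp [a1, a2, a3, e1, e2, e3]

/-- Build an induced embedding from a function matching adjacencies, injectivity being checked
separately. -/
lemma no_embed {n : ℕ} {H : SimpleGraph (Fin n)} {G : SimpleGraph V} (h : IsEmpty (H ↪g G))
    (f : Fin n → V) (hf : ∀ i j, i < j → f i ≠ f j)
    (hadj : ∀ i j, i < j → (G.Adj (f i) (f j) ↔ H.Adj i j)) : False := by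
  refine h.false ⟨⟨f, ?_⟩, ?_⟩
  · intro i j hij
    rcases lt_trichotomy i j with hlt | heq | hlt
    · exact absurd hij (hf i j hlt)
    · exact heq
    · exact absurd hij.symm (hf j i hlt)
  · intro i j
    change G.Adj (f i) (f j) ↔ H.Adj i j
    rcases lt_trichotomy i j with hlt | heq | hlt
    · exact hadj i j hlt
    · subst heq; simp
    · rw [G.adj_comm, H.adj_comm]; exact hadj j i hlt

end Stmt7

open Stmt7

theorem stmt7 {V : Type*} [Fintype V] (G : SimpleGraph V)
    (hP : IsEmpty (P3P2 ↪g G)) (hW : IsEmpty (W4 ↪g G)) (hK5 : G.CliqueFree 5)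
    (h2K3 : IsEmpty (twoK3 ↪g G)) (hP2K4 : IsEmpty (P2K4 ↪g G))
    (hQ : Nonempty (P2K3 ↪g G)) :
    G.chromaticNumber ≤ 8 := by
  have hP' : ∀ p q r s t, p ≠ r → G.Adj p q → G.Adj q r → ¬ G.Adj p r → G.Adj s t →
      ¬ G.Adj p s → ¬ G.Adj p t → ¬ G.Adj q s → ¬ G.Adj q t → ¬ G.Adj r s → ¬ G.Adj r t →
      False := by
    intro p q r s t hpr h1 h2 h3 h4 h5 h6 h7 h8 h9 h10
    refine no_embed hP ![p, q, r, s, t] ?_ ?_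
    · have := h1.ne
      have := h2.ne
      have := h4.ne
      have := G.adj_comm p q
      have := G.adj_comm q r
      intro i j hij
      fin_cases i <;> fin_cases j <;> simp at hij ⊢ <;> grind
    · intro i j hij
      fin_cases i <;> fin_cases j <;> simp [P3P2] at hij ⊢ <;> assumption
  have hW' : ∀ x y z w h, x ≠ z → y ≠ w → G.Adj x y → G.Adj y z →
      G.Adj z w → G.Adj w x → ¬ G.Adj x z → ¬ G.Adj y w →
      G.Adj h x → G.Adj h y → G.Adj h z → G.Adj h w → False := by
    intro x y z w h e1 e2 h1 h2 h3 h4 h5 h6 h7 h8 h9 h10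
    have h4 := h4.symm
    have h7 := h7.symm
    have h8 := h8.symm
    have h9 := h9.symm
    have h10 := h10.symm
    refine no_embed hW ![x, y, z, w, h] ?_ ?_
    · have := h1.ne
      have := h2.ne
      have := h3.ne
      have := h4.ne
      have := h7.ne
      have := h8.ne
      have := h9.ne
      have := h10.ne
      intro i j hij
      fin_cases i <;> fin_cases j <;> simp at hij ⊢ <;> assumption
    · intro i j hij
      fin_cases i <;> fin_cases j <;> simp [W4] at hij ⊢ <;> assumption
  have hK' : ∀ x y z w h, G.Adj x y → G.Adj x z → G.Adj x w → G.Adj x h → G.Adj y z →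
      G.Adj y w → G.Adj y h → G.Adj z w → G.Adj z h → G.Adj w h → False := by
    classical
    intro x y z w h h1 h2 h3 h4 h5 h6 h7 h8 h9 h10
    refine hK5 {x, y, z, w, h} ?_
    rw [isNClique_iff]
    constructor
    · simp [isClique_iff, Set.pairwise_insert, h1, h2, h3, h4, h5, h6, h7, h8, h9, h10,
        h1.symm, h2.symm, h3.symm, h4.symm, h5.symm, h6.symm, h7.symm, h8.symm, h9.symm, h10.symm]
    · simp [Finset.card_insert_of_notMem, h1.ne, h2.ne, h3.ne, h4.ne, h5.ne, h6.ne, h7.ne, h8.ne,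
        h9.ne, h10.ne]
  have hTT : ∀ x y z p q r, G.Adj x y → G.Adj y z → G.Adj x z → G.Adj p q → G.Adj q r →
      G.Adj p r →
      ¬ G.Adj x p → ¬ G.Adj x q → ¬ G.Adj x r → ¬ G.Adj y p → ¬ G.Adj y q → ¬ G.Adj y r →
      ¬ G.Adj z p → ¬ G.Adj z q → ¬ G.Adj z r → False := by
    intro x y z p q r h1 h2 h3 h4 h5 h6 n1 n2 n3 n4 n5 n6 n7 n8 n9
    refine no_embed h2K3 ![x, y, z, p, q, r] ?_ ?_
    · have := h1.ne
      have := h2.ne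
      have := h3.ne
      have := h4.ne
      have := h5.ne
      have := h6.ne
      have := G.adj_comm x y
      have := G.adj_comm x z
      intro i j hij
      fin_cases i <;> fin_cases j <;> simp at hij ⊢ <;> grind
    · intro i j hij
      fin_cases i <;> fin_cases j <;> simp [twoK3] at hij ⊢ <;> assumption
  have hPK : ∀ s t x y z w, G.Adj s t → G.Adj x y → G.Adj x z → G.Adj x w → G.Adj y z →
      G.Adj y w → G.Adj z w → ¬ G.Adj s x → ¬ G.Adj s y → ¬ G.Adj s z → ¬ G.Adj s w →
      ¬ G.Adj t x → ¬ G.Adj t y → ¬ G.Adj t z → ¬ G.Adj t w → False := by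
    intro s t x y z w h1 h2 h3 h4 h5 h6 h7 n1 n2 n3 n4 n5 n6 n7 n8
    refine no_embed hP2K4 ![s, t, x, y, z, w] ?_ ?_
    · have := h1.ne
      have := h2.ne
      have := h3.ne
      have := h4.ne
      have := h5.ne
      have := h6.ne
      have := h7.ne
      have := G.adj_comm s t
      intro i j hij
      fin_cases i <;> fin_cases j <;> simp at hij ⊢ <;> grind
    · intro i j hij
      fin_cases i <;> fin_cases j <;> simp [P2K4] at hij ⊢ <;> assumption
  obtain ⟨f⟩ := hQ
  have hf : ∀ i j, G.Adj (f i) (f j) ↔ P2K3.Adj i j := fun i j => f.map_adj_iff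
  obtain ⟨a, ha⟩ : ∃ a, a = f 0 := ⟨_, rfl⟩
  obtain ⟨b, hb⟩ : ∃ b, b = f 1 := ⟨_, rfl⟩
  obtain ⟨t₁, ht₁⟩ : ∃ t, t = f 2 := ⟨_, rfl⟩
  obtain ⟨t₂, ht₂⟩ : ∃ t, t = f 3 := ⟨_, rfl⟩
  obtain ⟨t₃, ht₃⟩ : ∃ t, t = f 4 := ⟨_, rfl⟩
  have hab : G.Adj a b := by rw [ha, hb, hf]; simp [P2K3]
  have h12 : G.Adj t₁ t₂ := by rw [ht₁, ht₂, hf]; simp [P2K3]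
  have h13 : G.Adj t₁ t₃ := by rw [ht₁, ht₃, hf]; simp [P2K3]
  have h23 : G.Adj t₂ t₃ := by rw [ht₂, ht₃, hf]; simp [P2K3]
  have a1 : ¬ G.Adj a t₁ := by rw [ha, ht₁, hf]; simp [P2K3]
  have a2 : ¬ G.Adj a t₂ := by rw [ha, ht₂, hf]; simp [P2K3]
  have a3 : ¬ G.Adj a t₃ := by rw [ha, ht₃, hf]; simp [P2K3]
  have b1 : ¬ G.Adj b t₁ := by rw [hb, ht₁, hf]; simp [P2K3]
  have b2 : ¬ G.Adj b t₂ := by rw [hb, ht₂, hf]; simp [P2K3]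
  have b3 : ¬ G.Adj b t₃ := by rw [hb, ht₃, hf]; simp [P2K3]
  clear ha hb ht₁ ht₂ ht₃
  -- vertices with exactly one neighbour `p` in the triangle `p q r` see both `a` and `b`
  have full : ∀ p q r : V, G.Adj p q → G.Adj q r →
      ¬ G.Adj a p → ¬ G.Adj a q → ¬ G.Adj a r → ¬ G.Adj b p → ¬ G.Adj b q → ¬ G.Adj b r →
      ∀ x, G.Adj x p → ¬ G.Adj x q → ¬ G.Adj x r → G.Adj x a ∧ G.Adj x b := by
    intro p q r hpq hqr ap aq ar bp bq br x xp xq xr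
    have hxq : x ≠ q := by
      rintro rfl; exact xr hqr
    have hxa : x ≠ a := by
      rintro rfl; exact ap xp
    have hxb : x ≠ b := by
      rintro rfl; exact bp xp
    have k1 := hP' x p q a b hxq xp hpq xq hab
    have k2 := hP' x a b q r hxb
    have k3 := hP' x b a q r hxa
    have := G.adj_comm a p
    have := G.adj_comm a q
    have := G.adj_comm b p
    have := G.adj_comm b q
    have := G.adj_comm a b
    grind
  have uniq : ∀ p q r : V, G.Adj p q → G.Adj q r →
      ¬ G.Adj a p → ¬ G.Adj a q → ¬ G.Adj a r → ¬ G.Adj b p → ¬ G.Adj b q → ¬ G.Adj b r →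
      ∀ x y, G.Adj x p → ¬ G.Adj x q → ¬ G.Adj x r →
        G.Adj y p → ¬ G.Adj y q → ¬ G.Adj y r → x = y := by
    intro p q r hpq hqr ap aq ar bp bq br x y xp xq xr yp yq yr
    by_contra hne
    obtain ⟨xa, xb⟩ := full p q r hpq hqr ap aq ar bp bq br x xp xq xr
    obtain ⟨ya, yb⟩ := full p q r hpq hqr ap aq ar bp bq br y yp yq yr
    by_cases hxy : G.Adj x y
    · refine hPK q r a b x y hqr hab xa.symm ya.symm xb.symm yb.symm hxy ?_ ?_ ?_ ?_ ?_ ?_ ?_ ?_ <;>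
        (rw [G.adj_comm]; assumption)
    · exact hP' x a y q r hne xa ya.symm hxy hqr xq xr aq ar yq yr
  have f1 := full t₁ t₂ t₃ h12 h23 a1 a2 a3 b1 b2 b3
  have f2 := full t₂ t₁ t₃ h12.symm h13 a2 a1 a3 b2 b1 b3
  have f3 := full t₃ t₁ t₂ h13.symm h12 a3 a1 a2 b3 b1 b2
  have u1 := uniq t₁ t₂ t₃ h12 h23 a1 a2 a3 b1 b2 b3
  have u2 := uniq t₂ t₁ t₃ h12.symm h13 a2 a1 a3 b2 b1 b3
  have u3 := uniq t₃ t₁ t₂ h13.symm h12 a3 a1 a2 b3 b1 b2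
  refine Colorable.chromaticNumber_le (n := 8) ?_
  by_cases c12 : ∀ x y, G.Adj x t₁ → ¬ G.Adj x t₂ → ¬ G.Adj x t₃ →
      G.Adj y t₂ → ¬ G.Adj y t₁ → ¬ G.Adj y t₃ → ¬ G.Adj x y
  · exact core hP' hW' hK' hTT t₁ t₂ t₃ h12 h13 h23 c12 u1 u2 u3
  by_cases c13 : ∀ x y, G.Adj x t₁ → ¬ G.Adj x t₃ → ¬ G.Adj x t₂ →
      G.Adj y t₃ → ¬ G.Adj y t₁ → ¬ G.Adj y t₂ → ¬ G.Adj x y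
  · exact core hP' hW' hK' hTT t₁ t₃ t₂ h13 h12 h23.symm c13
      (fun x y p q r p' q' r' => u1 x y p r q p' r' q') u3 u2
  by_cases c23 : ∀ x y, G.Adj x t₂ → ¬ G.Adj x t₃ → ¬ G.Adj x t₁ →
      G.Adj y t₃ → ¬ G.Adj y t₂ → ¬ G.Adj y t₁ → ¬ G.Adj x y
  · exact core hP' hW' hK' hTT t₂ t₃ t₁ h23 h12.symm h13.symm c23
      (fun x y p q r p' q' r' => u2 x y p r q p' r' q')
      (fun x y p q r p' q' r' => u3 x y p r q p' r' q') u1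
  exfalso
  push Not at c12 c13 c23
  obtain ⟨x, y, x1, x2, x3, y2, y1, y3, hxy⟩ := c12
  obtain ⟨x', z, x1', x3', x2', z3, z1, z2, hxz⟩ := c13
  obtain ⟨y', z', y2', y3', y1', z3', z2', z1', hyz⟩ := c23
  obtain rfl := u1 x x' x1 x2 x3 x1' x2' x3'
  obtain rfl := u2 y y' y2 y1 y3 y2' y1' y3'
  obtain rfl := u3 z z' z3 z1 z2 z3' z1' z2'
  obtain ⟨xa, xb⟩ := f1 x x1 x2 x3
  obtain ⟨ya, yb⟩ := f2 y y2 y1 y3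
  obtain ⟨za, zb⟩ := f3 z z3 z1 z2
  exact hK' x y z a b hxy hxz xa xb hyz ya yb za zb hab
end

section
/- Let G be a finite simple graph that is (P3∪P2)-free, W4-free, K5-free and (P2∪K3)-free. If G contains an induced subgraph isomorphic to the 4-triangle, then χ(G) ≤ 8. -/
open SimpleGraph

/-- The 4-triangle: 6-cycle u1 v1 u2 v2 u3 v3 (= 0 1 2 3 4 5) plus triangle v1 v2 v3 (= 1 3 5). -/
def fourTriangle : SimpleGraph (Fin 6) :=
  SimpleGraph.fromEdgeSet {s(0,1), s(1,2), s(2,3), s(3,4), s(4,5), s(5,0),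
    s(1,3), s(3,5), s(1,5)}

theorem noP {V : Type*} {G : SimpleGraph V} (hP : IsEmpty (P3P2 ↪g G)) {a b c d e : V}
    (h1 : G.Adj a b) (h2 : G.Adj b c) (h3 : G.Adj d e) (hac : a ≠ c) (n1 : ¬ G.Adj a c)
    (n2 : ¬ G.Adj a d) (n3 : ¬ G.Adj a e) (n4 : ¬ G.Adj b d) (n5 : ¬ G.Adj b e)
    (n6 : ¬ G.Adj c d) (n7 : ¬ G.Adj c e) : False := by
  have k1 : a ≠ d := by rintro rfl; exact n4 h1.symm
  have k2 : a ≠ e := by rintro rfl; exact n5 h1.symm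
  have k3 : b ≠ d := by rintro rfl; exact n2 h1
  have k4 : b ≠ e := by rintro rfl; exact n3 h1
  have k5 : c ≠ d := by rintro rfl; exact n4 h2
  have k6 : c ≠ e := by rintro rfl; exact n5 h2
  refine hP.elim ⟨⟨![a, b, c, d, e], ?_⟩, ?_⟩
  · intro i j
    fin_cases i <;> fin_cases j <;>
      simp [h1.ne, h2.ne, h3.ne, h1.ne', h2.ne', h3.ne', hac, hac.symm, k1, k2, k3, k4, k5, k6,
        k1.symm, k2.symm, k3.symm, k4.symm, k5.symm, k6.symm]
  · intro i j
    change G.Adj (![a, b, c, d, e] i) (![a, b, c, d, e] j) ↔ _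
    fin_cases i <;> fin_cases j <;>
      simp [P3P2, h1, h2, h3, h1.symm, h2.symm, h3.symm, n1, n2, n3, n4, n5, n6, n7,
        G.adj_comm c a, G.adj_comm d a, G.adj_comm e a, G.adj_comm d b, G.adj_comm e b,
        G.adj_comm d c, G.adj_comm e c]

theorem noT {V : Type*} {G : SimpleGraph V} (hP : IsEmpty (P2K3 ↪g G)) {a b c d e : V}
    (h1 : G.Adj a b) (h2 : G.Adj c d) (h3 : G.Adj d e) (h4 : G.Adj c e)
    (n2 : ¬ G.Adj a c) (n3 : ¬ G.Adj a d) (n4 : ¬ G.Adj a e) (n5 : ¬ G.Adj b c)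
    (n6 : ¬ G.Adj b d) (n7 : ¬ G.Adj b e) : False := by
  have k1 : a ≠ c := by rintro rfl; exact n5 h1.symm
  have k2 : a ≠ d := by rintro rfl; exact n6 h1.symm
  have k3 : a ≠ e := by rintro rfl; exact n7 h1.symm
  have k4 : b ≠ c := by rintro rfl; exact n2 h1
  have k5 : b ≠ d := by rintro rfl; exact n3 h1
  have k6 : b ≠ e := by rintro rfl; exact n4 h1
  refine hP.elim ⟨⟨![a, b, c, d, e], ?_⟩, ?_⟩
  · intro i j
    fin_cases i <;> fin_cases j <;>
      simp [h1.ne, h2.ne, h3.ne, h1.ne', h2.ne', h3.ne', h4.ne, h4.ne', k1, k2, k3, k4, k5, k6,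
        k1.symm, k2.symm, k3.symm, k4.symm, k5.symm, k6.symm]
  · intro i j
    change G.Adj (![a, b, c, d, e] i) (![a, b, c, d, e] j) ↔ _
    fin_cases i <;> fin_cases j <;>
      simp [P2K3, h1, h2, h3, h4, h1.symm, h2.symm, h3.symm, h4.symm, n2, n3, n4, n5, n6, n7,
        G.adj_comm c a, G.adj_comm d a, G.adj_comm e a, G.adj_comm c b, G.adj_comm d b,
        G.adj_comm e b]

/-- No induced 4-cycle `a b c d` with a hub `e`. -/
theorem noW {V : Type*} {G : SimpleGraph V} (hP : IsEmpty (W4 ↪g G)) {a b c d e : V}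
    (h1 : G.Adj a b) (h2 : G.Adj b c) (h3 : G.Adj c d) (h4 : G.Adj d a)
    (e1 : G.Adj e a) (e2 : G.Adj e b) (e3 : G.Adj e c) (e4 : G.Adj e d)
    (k1 : a ≠ c) (k2 : b ≠ d) (n1 : ¬ G.Adj a c) (n2 : ¬ G.Adj b d) : False := by
  refine hP.elim ⟨⟨![a, b, c, d, e], ?_⟩, ?_⟩
  · intro i j
    fin_cases i <;> fin_cases j <;>
      simp [h1.ne, h2.ne, h3.ne, h1.ne', h2.ne', h3.ne', h4.ne, h4.ne', k1, k2,
        k1.symm, k2.symm, e1.ne, e2.ne, e3.ne, e4.ne, e1.ne', e2.ne', e3.ne', e4.ne']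
  · intro i j
    change G.Adj (![a, b, c, d, e] i) (![a, b, c, d, e] j) ↔ _
    fin_cases i <;> fin_cases j <;>
      simp [W4, h1, h2, h3, h4, h1.symm, h2.symm, h3.symm, h4.symm, n1, n2,
        e1, e2, e3, e4, e1.symm, e2.symm, e3.symm, e4.symm,
        G.adj_comm c a, G.adj_comm d b]

/-- The vertices anticomplete to an edge `p q` can be properly coloured with two colours. -/
theorem twoCol {V : Type*} {G : SimpleGraph V} [Fintype V] (hP : IsEmpty (P3P2 ↪g G))
    (hT : IsEmpty (P2K3 ↪g G)) {p q : V} (h : G.Adj p q) :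
    ∃ f : V → Fin 2, ∀ x y, G.Adj x y → ¬ G.Adj p x → ¬ G.Adj q x → ¬ G.Adj p y → ¬ G.Adj q y →
      f x ≠ f y := by
  classical
  let r := Fintype.equivFin V
  have uniq : ∀ x y z, G.Adj x y → G.Adj x z → ¬ G.Adj p x → ¬ G.Adj q x → ¬ G.Adj p y →
      ¬ G.Adj q y → ¬ G.Adj p z → ¬ G.Adj q z → y = z := by
    intro x y z hxy hxz a1 a2 a3 a4 a5 a6
    by_contra hne
    by_cases hyz : G.Adj y z
    · exact noT hT h hxy hyz hxz a1 a3 a5 a2 a4 a6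
    · exact noP hP hxy.symm hxz h hne hyz (fun t => a3 t.symm) (fun t => a4 t.symm)
        (fun t => a1 t.symm) (fun t => a2 t.symm) (fun t => a5 t.symm) (fun t => a6 t.symm)
  have key : ∀ x y, r x < r y → G.Adj x y → ¬ G.Adj p x → ¬ G.Adj q x → ¬ G.Adj p y →
      ¬ G.Adj q y →
      (∃ z, r z < r y ∧ G.Adj y z ∧ ¬ G.Adj p z ∧ ¬ G.Adj q z) ∧
      ¬ (∃ z, r z < r x ∧ G.Adj x z ∧ ¬ G.Adj p z ∧ ¬ G.Adj q z) := by
    intro x y hlt hxy a1 a2 a3 a4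
    refine ⟨⟨x, hlt, hxy.symm, a1, a2⟩, ?_⟩
    rintro ⟨z, hz, hxz, a5, a6⟩
    have := uniq x y z hxy hxz a1 a2 a3 a4 a5 a6
    subst this
    exact absurd (hz.trans hlt) (lt_irrefl _)
  refine ⟨fun x => if ∃ z, r z < r x ∧ G.Adj x z ∧ ¬ G.Adj p z ∧ ¬ G.Adj q z then 1 else 0, ?_⟩
  intro x y hxy a1 a2 a3 a4
  rcases lt_trichotomy (r x) (r y) with hlt | heq | hlt
  · obtain ⟨k1, k2⟩ := key x y hlt hxy a1 a2 a3 a4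
    simp only [if_pos k1, if_neg k2]; decide
  · exact absurd (r.injective heq) hxy.ne
  · obtain ⟨k1, k2⟩ := key y x hlt hxy.symm a3 a4 a1 a2
    simp only [if_pos k1, if_neg k2]; decide

/-- Two vertices adjacent to `p`, `q` but not to `r` are not adjacent; here `s` sees `p, r`
and `t` sees `q, r`. -/
theorem same {V : Type*} {G : SimpleGraph V} (hP : IsEmpty (P3P2 ↪g G)) (hW : IsEmpty (W4 ↪g G))
    {p q r s t : V} (hpq : G.Adj p q) (hpr : G.Adj p r) (hqr : G.Adj q r)
    (hsp : G.Adj s p) (hsr : G.Adj s r) (hsq : ¬ G.Adj s q) (hsq' : s ≠ q)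
    (htq : G.Adj t q) (htr : G.Adj t r) (htp : ¬ G.Adj t p) (htp' : t ≠ p)
    (hst : ¬ G.Adj s t) (hst' : s ≠ t) {x y : V} (hxy : G.Adj x y)
    (xp : G.Adj p x) (xq : G.Adj q x) (xr : ¬ G.Adj r x) (xr' : x ≠ r)
    (yp : G.Adj p y) (yq : G.Adj q y) (yr : ¬ G.Adj r y) (yr' : y ≠ r) : False := by
  have ns : ∀ x, G.Adj p x → G.Adj q x → ¬ G.Adj r x → x ≠ r → ¬ G.Adj s x := by
    intro x xp xq xr xr' hs
    exact noW hW hs.symm hsr hqr.symm xq xp hsp.symm hpr hpq xr' hsq'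
      (fun h => xr h.symm) hsq
  have nt : ∀ x, G.Adj p x → G.Adj q x → ¬ G.Adj r x → x ≠ r → ¬ G.Adj t x := by
    intro x xp xq xr xr' hs
    exact noW hW hs.symm htr hpr.symm xp xq htq.symm hqr hpq.symm xr' htp'
      (fun h => xr h.symm) htp
  exact noP hP hsr htr.symm hxy hst' hst (ns x xp xq xr xr') (ns y yp yq yr yr') xr yr
    (nt x xp xq xr xr') (nt y yp yq yr yr')

/-- A vertex seeing `p, q` not `r`, and a vertex seeing `p, r` not `q`, are not adjacent. -/
theorem diff {V : Type*} {G : SimpleGraph V} (hW : IsEmpty (W4 ↪g G))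
    {p q r : V} (hpq : G.Adj p q) (hpr : G.Adj p r) (hqr : G.Adj q r) {x y : V} (hxy : G.Adj x y)
    (xp : G.Adj p x) (xq : G.Adj q x) (xr : ¬ G.Adj r x) (xr' : x ≠ r)
    (yp : G.Adj p y) (yr : G.Adj r y) (yq : ¬ G.Adj q y) (yq' : y ≠ q) : False :=
  noW hW hxy yr.symm hqr.symm xq xp yp hpr hpq xr' yq' (fun h => xr h.symm) (fun h => yq h.symm)

theorem noK {V : Type*} {G : SimpleGraph V} (hK : G.CliqueFree 5) {p q r x y : V}
    (hpq : G.Adj p q) (hpr : G.Adj p r) (hqr : G.Adj q r) (hxy : G.Adj x y)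
    (xp : G.Adj p x) (xq : G.Adj q x) (xr : G.Adj r x)
    (yp : G.Adj p y) (yq : G.Adj q y) (yr : G.Adj r y) : False := by
  classical
  refine hK {p, q, r, x, y} ?_
  have h3 : G.IsNClique 3 {r, x, y} := is3Clique_iff.2 ⟨r, x, y, xr, yr, hxy, rfl⟩
  refine (h3.insert (a := q) ?_).insert ?_
  · intro b hb
    simp only [Finset.mem_insert, Finset.mem_singleton] at hb
    rcases hb with rfl | rfl | rfl <;> assumption
  · intro b hb
    simp only [Finset.mem_insert, Finset.mem_singleton] at hb
    rcases hb with rfl | rfl | rfl | rfl <;> assumption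

set_option maxHeartbeats 4000000 in
theorem stmt8 {V : Type*} [Fintype V] (G : SimpleGraph V)
    (hP : IsEmpty (P3P2 ↪g G)) (hW : IsEmpty (W4 ↪g G)) (hK5 : G.CliqueFree 5)
    (hP2K3 : IsEmpty (P2K3 ↪g G)) (hQ : Nonempty (fourTriangle ↪g G)) :
    G.chromaticNumber ≤ 8 := by
  classical
  obtain ⟨φ⟩ := hQ
  have A : ∀ i j, fourTriangle.Adj i j → G.Adj (φ i) (φ j) := fun i j h => φ.map_rel_iff.2 h
  have N : ∀ i j, ¬ fourTriangle.Adj i j → ¬ G.Adj (φ i) (φ j) :=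
    fun i j h h' => h (φ.map_rel_iff.1 h')
  have D : ∀ i j, i ≠ j → φ i ≠ φ j := fun i j h h' => h (φ.injective h')
  have a13 := A 1 3 (by simp [fourTriangle])
  have a15 := A 1 5 (by simp [fourTriangle])
  have a35 := A 3 5 (by simp [fourTriangle])
  have a01 := A 0 1 (by simp [fourTriangle])
  have a05 := A 0 5 (by simp [fourTriangle])
  have a21 := A 2 1 (by simp [fourTriangle])
  have a23 := A 2 3 (by simp [fourTriangle])
  have a43 := A 4 3 (by simp [fourTriangle])
  have a45 := A 4 5 (by simp [fourTriangle])
  have n03 := N 0 3 (by simp [fourTriangle])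
  have n25 := N 2 5 (by simp [fourTriangle])
  have n41 := N 4 1 (by simp [fourTriangle])
  have n02 := N 0 2 (by simp [fourTriangle])
  have n04 := N 0 4 (by simp [fourTriangle])
  have n24 := N 2 4 (by simp [fourTriangle])
  have d03 := D 0 3 (by decide)
  have d25 := D 2 5 (by decide)
  have d41 := D 4 1 (by decide)
  have d02 := D 0 2 (by decide)
  have d04 := D 0 4 (by decide)
  have d24 := D 2 4 (by decide)
  generalize φ 0 = u0 at *
  generalize φ 1 = p at *
  generalize φ 2 = u2 at *
  generalize φ 3 = q at *
  generalize φ 4 = u4 at *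
  generalize φ 5 = r at *
  clear A N D
  obtain ⟨f, hf⟩ := twoCol hP hP2K3 a13
  obtain ⟨g, hg⟩ := twoCol hP hP2K3 a35
  obtain ⟨k, hk⟩ := twoCol hP hP2K3 a15
  -- The three colour blocks, for vertices outside the central triangle.
  let c : V → Fin 8 := fun x =>
    if x = p then 0 else if x = q then 2 else if x = r then 4 else
    if G.Adj p x then
      if G.Adj q x then
        if G.Adj r x then 7 else 6
      else if G.Adj r x then 6 else (if g x = 0 then 2 else 3)
    else if G.Adj q x then
      if G.Adj r x then 6 else (if k x = 0 then 4 else 5)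
    else (if f x = 0 then 0 else 1)
  have hc : ∀ x y, G.Adj x y → c x ≠ c y := by
    have two : ∀ a b : Fin 2, a ≠ 0 → b ≠ 0 → a = b := by decide
    have spec : ∀ x, (x = p ∧ c x = 0) ∨ (x = q ∧ c x = 2) ∨ (x = r ∧ c x = 4) ∨
        (x ≠ p ∧ x ≠ q ∧ x ≠ r ∧ (
          (G.Adj p x ∧ G.Adj q x ∧ G.Adj r x ∧ c x = 7) ∨
          (G.Adj p x ∧ G.Adj q x ∧ ¬ G.Adj r x ∧ c x = 6) ∨
          (G.Adj p x ∧ ¬ G.Adj q x ∧ G.Adj r x ∧ c x = 6) ∨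
          (G.Adj p x ∧ ¬ G.Adj q x ∧ ¬ G.Adj r x ∧ g x = 0 ∧ c x = 2) ∨
          (G.Adj p x ∧ ¬ G.Adj q x ∧ ¬ G.Adj r x ∧ g x ≠ 0 ∧ c x = 3) ∨
          (¬ G.Adj p x ∧ G.Adj q x ∧ G.Adj r x ∧ c x = 6) ∨
          (¬ G.Adj p x ∧ G.Adj q x ∧ ¬ G.Adj r x ∧ k x = 0 ∧ c x = 4) ∨
          (¬ G.Adj p x ∧ G.Adj q x ∧ ¬ G.Adj r x ∧ k x ≠ 0 ∧ c x = 5) ∨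
          (¬ G.Adj p x ∧ ¬ G.Adj q x ∧ f x = 0 ∧ c x = 0) ∨
          (¬ G.Adj p x ∧ ¬ G.Adj q x ∧ f x ≠ 0 ∧ c x = 1))) := by
      intro x
      simp only [c]
      split_ifs <;> simp_all
    intro x y hxy heq
    have hyx := hxy.symm
    have sx := spec x
    have sy := spec y
    clear spec
    clear_value c
    rcases sx with (⟨rfl, ex⟩ | ⟨rfl, ex⟩ | ⟨rfl, ex⟩ | ⟨i1, i2, i3, (⟨j0, j1, j2, ex⟩ | ⟨j0, j1, j2, ex⟩ | ⟨j0, j1, j2, ex⟩ | ⟨j0, j1, j2, j3, ex⟩ | ⟨j0, j1, j2, j3, ex⟩ | ⟨j0, j1, j2, ex⟩ | ⟨j0, j1, j2, j3, ex⟩ | ⟨j0, j1, j2, j3, ex⟩ | ⟨j0, j1, j2, ex⟩ | ⟨j0, j1, j2, ex⟩)⟩) <;>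
    rcases sy with (⟨rfl, ey⟩ | ⟨rfl, ey⟩ | ⟨rfl, ey⟩ | ⟨i4, i5, i6, (⟨l0, l1, l2, ey⟩ | ⟨l0, l1, l2, ey⟩ | ⟨l0, l1, l2, ey⟩ | ⟨l0, l1, l2, l3, ey⟩ | ⟨l0, l1, l2, l3, ey⟩ | ⟨l0, l1, l2, ey⟩ | ⟨l0, l1, l2, l3, ey⟩ | ⟨l0, l1, l2, l3, ey⟩ | ⟨l0, l1, l2, ey⟩ | ⟨l0, l1, l2, ey⟩)⟩) <;>
    replace heq := ex.symm.trans (heq.trans ey)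
    all_goals first
      | exact absurd heq (by decide)
      | exact hxy.ne rfl
      | contradiction
      | (refine hf x y hxy ‹_› ‹_› ‹_› ‹_› ?_; first | (simp only [*]; done) | (apply two <;> assumption))
      | (refine hg x y hxy ‹_› ‹_› ‹_› ‹_› ?_; first | (simp only [*]; done) | (apply two <;> assumption))
      | (refine hk x y hxy ‹_› ‹_› ‹_› ‹_› ?_; first | (simp only [*]; done) | (apply two <;> assumption))
      | exact noK hK5 a13 a15 a35 hxy ‹_› ‹_› ‹_› ‹_› ‹_› ‹_›
      | exact same hP hW a13 a15 a35 a01 a05 n03 d03 a43 a45 n41 d41 n04 d04 hxy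
          ‹_› ‹_› ‹_› ‹_› ‹_› ‹_› ‹_› ‹_›
      | exact same hP hW a15 a13 a35.symm a21 a23 n25 d25 a45 a43 n41 d41 n24 d24 hxy
          ‹_› ‹_› ‹_› ‹_› ‹_› ‹_› ‹_› ‹_›
      | exact same hP hW a35 a13.symm a15.symm a23 a21 n25 d25 a05 a01 n03 d03
          (fun h => n02 h.symm) d02.symm hxy ‹_› ‹_› ‹_› ‹_› ‹_› ‹_› ‹_› ‹_›
      | exact diff hW a13 a15 a35 hxy ‹_› ‹_› ‹_› ‹_› ‹_› ‹_› ‹_› ‹_›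
      | exact diff hW a13 a15 a35 hyx ‹_› ‹_› ‹_› ‹_› ‹_› ‹_› ‹_› ‹_›
      | exact diff hW a13.symm a35 a15 hxy ‹_› ‹_› ‹_› ‹_› ‹_› ‹_› ‹_› ‹_›
      | exact diff hW a13.symm a35 a15 hyx ‹_› ‹_› ‹_› ‹_› ‹_› ‹_› ‹_› ‹_›
      | exact diff hW a15.symm a35.symm a13 hxy ‹_› ‹_› ‹_› ‹_› ‹_› ‹_› ‹_› ‹_›
      | exact diff hW a15.symm a35.symm a13 hyx ‹_› ‹_› ‹_› ‹_› ‹_› ‹_› ‹_› ‹_›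
  exact Colorable.chromaticNumber_le ⟨Coloring.mk c (fun {x y} h => hc x y h)⟩
end

section
/- Let G be a finite simple graph that is (P3∪P2)-free, W4-free, K5-free, (P2∪K3)-free and 4-triangle-free. If G contains an induced subgraph isomorphic to the gem, then χ(G) ≤ 8. -/
open SimpleGraph

/-- The gem: path 0-1-2-3 plus a vertex 4 adjacent to all path vertices. -/
def gem : SimpleGraph (Fin 5) :=
  SimpleGraph.fromEdgeSet {s(0,1), s(1,2), s(2,3), s(4,0), s(4,1), s(4,2), s(4,3)}

/-- First-order form of the forbidden-subgraph hypotheses. -/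
structure FreeHyp {V : Type*} (A : V → V → Prop) : Prop where
  symm : ∀ u v, A u v → A v u
  irrefl : ∀ u, ¬ A u u
  p3p2 : ∀ p q r s t, p ≠ r → A p q → A q r → ¬ A p r → A s t → ¬ A p s → ¬ A p t →
    ¬ A q s → ¬ A q t → ¬ A r s → ¬ A r t → False
  w4 : ∀ p q r s t, p ≠ r → q ≠ s → A p q → A q r → A r s → A s p → ¬ A p r → ¬ A q s →
    A t p → A t q → A t r → A t s → False
  k5 : ∀ p q r s t, A p q → A p r → A p s → A p t → A q r → A q s → A q t → A r s → A r t →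
    A s t → False
  p2k3 : ∀ p q r s t, A p q → A r s → A s t → A r t → ¬ A p r → ¬ A p s → ¬ A p t →
    ¬ A q r → ¬ A q s → ¬ A q t → False
  ft : ∀ p q r s t u, A p q → A q r → A r s → A s t → A t u → A u p → A q s → A s u → A q u →
    ¬ A p r → ¬ A p s → ¬ A p t → ¬ A r t → ¬ A r u → ¬ A t q → False

/-- `a b c d` is an induced path and `e` is adjacent to all of it. -/
structure IsGem {V : Type*} (A : V → V → Prop) (a b c d e : V) : Prop where
  ab : A a b
  bc : A b c
  cd : A c d
  ea : A e a
  eb : A e b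
  ec : A e c
  ed : A e d
  ac : ¬ A a c
  ad : ¬ A a d
  bd : ¬ A b d
  nac : a ≠ c
  nad : a ≠ d
  nbd : b ≠ d

/-- `x` is not a vertex of the gem. -/
def Outside {V : Type*} (a b c d e x : V) : Prop := x ≠ a ∧ x ≠ b ∧ x ≠ c ∧ x ≠ d ∧ x ≠ e

theorem IsGem.flip {V : Type*} {A : V → V → Prop} (hF : FreeHyp A) {a b c d e : V}
    (h : IsGem A a b c d e) : IsGem A d c b a e :=
  ⟨hF.symm _ _ h.cd, hF.symm _ _ h.bc, hF.symm _ _ h.ab, h.ed, h.ec, h.eb, h.ea,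
    fun k => h.bd (hF.symm _ _ k), fun k => h.ad (hF.symm _ _ k), fun k => h.ac (hF.symm _ _ k),
    h.nbd.symm, h.nad.symm, h.nac.symm⟩

section core
variable {V : Type*} {A : V → V → Prop}

theorem excl (hF : FreeHyp A) {a b c d e x : V} (hg : IsGem A a b c d e)
    (hx : Outside a b c d e x) :
    ¬ (A x b ∧ A x c ∧ ¬ A x e) ∧ ¬ (A x a ∧ A x c ∧ A x e ∧ ¬ A x b) ∧
    ¬ (A x b ∧ A x d ∧ A x e ∧ ¬ A x c) := by
  have hs := hF.symm
  have h1 := hF.w4 a e c x b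
  have h2 := hF.w4 a b c x e
  have h3 := hF.w4 b c d x e
  have h4 := hF.ft a b x c d e
  have h5 := hF.w4 b e d x c
  obtain ⟨_, _, _, _, _, _, _, _, _, _, _, _, _⟩ := hg
  obtain ⟨_, _, _, _, _⟩ := hx
  grind

/-- First stable class: types 0, a, ab, e, ae, abe. -/
theorem stab1 (hF : FreeHyp A) {a b c d e x y : V} (hg : IsGem A a b c d e)
    (hx : Outside a b c d e x) (hy : Outside a b c d e y)
    (tx : ¬ A x c ∧ ¬ A x d ∧ (A x a ∨ ¬ A x b)) (ty : ¬ A y c ∧ ¬ A y d ∧ (A y a ∨ ¬ A y b)) :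
    ¬ A x y := by
  have hs := hF.symm
  have h1 := hF.p3p2 b c d x y
  have h2 := hF.p2k3 c d a x y
  have h3 := hF.p3p2 a y x c d
  have h4 := hF.p3p2 a x y c d
  obtain ⟨_, _, _, _, _, _, _, _, _, _, _, _, _⟩ := hg
  obtain ⟨_, _, _, _, _⟩ := hx
  obtain ⟨_, _, _, _, _⟩ := hy
  grind

/-- Second stable class: types c, d, cd, de, cde. -/
theorem stab2 (hF : FreeHyp A) {a b c d e x y : V} (hg : IsGem A a b c d e)
    (hx : Outside a b c d e x) (hy : Outside a b c d e y)
    (tx : ¬ A x a ∧ ¬ A x b ∧ (A x d ∨ (A x c ∧ ¬ A x e)))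
    (ty : ¬ A y a ∧ ¬ A y b ∧ (A y d ∨ (A y c ∧ ¬ A y e))) :
    ¬ A x y := by
  have hs := hF.symm
  have h1 := hF.p2k3 a b d x y
  have h2 := hF.p2k3 x y a b e
  have h3 := hF.p3p2 d y x a b
  have h4 := hF.p3p2 d x y a b
  obtain ⟨_, _, _, _, _, _, _, _, _, _, _, _, _⟩ := hg
  obtain ⟨_, _, _, _, _⟩ := hx
  obtain ⟨_, _, _, _, _⟩ := hy
  grind

/-- Types containing the triangle b, c, e. -/
theorem stab5 (hF : FreeHyp A) {a b c d e x y : V} (hg : IsGem A a b c d e)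
    (tx : A x b ∧ A x c ∧ A x e) (ty : A y b ∧ A y c ∧ A y e) : ¬ A x y := by
  have hs := hF.symm
  have h1 := hF.k5 b c e x y
  obtain ⟨_, _, _, _, _, _, _, _, _, _, _, _, _⟩ := hg
  grind

/-- No edges between type be and type ce. -/
theorem cross34 (hF : FreeHyp A) {a b c d e x y : V} (hg : IsGem A a b c d e)
    (hx : Outside a b c d e x) (hy : Outside a b c d e y)
    (tx : ¬ A x c ∧ A x b ∧ A x e) (ty : ¬ A y b ∧ A y c ∧ A y e) : ¬ A x y := by
  have hs := hF.symm
  have h1 := hF.w4 b c y x e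
  obtain ⟨_, _, _, _, _, _, _, _, _, _, _, _, _⟩ := hg
  obtain ⟨_, _, _, _, _⟩ := hx
  obtain ⟨_, _, _, _, _⟩ := hy
  grind

/-- No edges between types ac, ad, acd and type ade. -/
theorem cross7 (hF : FreeHyp A) {a b c d e x y : V} (hg : IsGem A a b c d e)
    (hx : Outside a b c d e x) (hy : Outside a b c d e y)
    (tx : A x a ∧ ¬ A x b ∧ ¬ A x e ∧ (A x c ∨ A x d))
    (ty : A y a ∧ ¬ A y b ∧ ¬ A y c ∧ A y d ∧ A y e) : ¬ A x y := by
  have hs := hF.symm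
  have h1 := hF.w4 a e d x y
  have h2 := hF.ft b a x y d e
  obtain ⟨_, _, _, _, _, _, _, _, _, _, _, _, _⟩ := hg
  obtain ⟨_, _, _, _, _⟩ := hx
  obtain ⟨_, _, _, _, _⟩ := hy
  grind

set_option maxHeartbeats 4000000 in
/-- An edge in types b, bd, abd excludes an edge in types ac, acd. -/
theorem dich (hF : FreeHyp A) {a b c d e x y z w : V} (hg : IsGem A a b c d e)
    (hx : Outside a b c d e x) (hy : Outside a b c d e y)
    (hz : Outside a b c d e z) (hw : Outside a b c d e w)
    (tx : A x b ∧ ¬ A x c ∧ ¬ A x e ∧ (A x a → A x d))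
    (ty : A y b ∧ ¬ A y c ∧ ¬ A y e ∧ (A y a → A y d))
    (tz : A z a ∧ ¬ A z b ∧ A z c ∧ ¬ A z e)
    (tw : A w a ∧ ¬ A w b ∧ A w c ∧ ¬ A w e) (hxy : A x y) (hzw : A z w) : False := by
  have hs := hF.symm
  have h1 := hF.p3p2 a e c x y
  have h2 := hF.p3p2 e c w x y
  have h3 := hF.p3p2 b e d z w
  have h4 := hF.p3p2 e c z x y
  have h5 := hF.ft z a e b x y
  have h6 := hF.w4 a b x z y
  have h7 := hF.ft z a e b y x
  have h8 := hF.w4 a b y z x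
  have h9 := hF.p3p2 e b y z w
  have h10 := hF.p3p2 e b x z w
  have h11 := hF.ft b a z w d y
  have h12 := hF.w4 a y d z w
  have h13 := hF.ft w a e b y x
  have h14 := hF.w4 a x y z w
  have h15 := hF.w4 c d x w z
  have h16 := hF.w4 a y d w x
  have h17 := hF.ft w c e d x z
  have h18 := hF.w4 c d y z w
  have h19 := hF.w4 a x d z y
  have h20 := hF.ft w a e b x y
  have h21 := hF.w4 a y x z w
  have h22 := hF.w4 a x d w z
  have h23 := hF.k5 d x y z w
  obtain ⟨_, _, _, _, _, _, _, _, _, _, _, _, _⟩ := hg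
  obtain ⟨_, _, _, _, _⟩ := hx
  obtain ⟨_, _, _, _, _⟩ := hy
  obtain ⟨_, _, _, _, _⟩ := hz
  obtain ⟨_, _, _, _, _⟩ := hw
  clear hF
  have hxz : x ≠ z := by grind
  have hxw : x ≠ w := by grind
  have hyz : y ≠ z := by grind
  have hyw : y ≠ w := by grind
  by_cases k1 : A x a <;> by_cases k2 : A y a <;> by_cases k3 : A z d <;> by_cases k4 : A w d <;>
    by_cases k5 : A x z <;> by_cases k6 : A y z <;> grind (splits := 30) +splitImp

/-- An edge from type b to types b, bd, abd excludes type ade. -/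
theorem noade (hF : FreeHyp A) {a b c d e x y z : V} (hg : IsGem A a b c d e)
    (hx : Outside a b c d e x) (hy : Outside a b c d e y) (hz : Outside a b c d e z)
    (tx : A x b ∧ ¬ A x c ∧ ¬ A x e ∧ ¬ A x a ∧ ¬ A x d)
    (ty : A y b ∧ ¬ A y c ∧ ¬ A y e ∧ (A y a → A y d))
    (tz : A z a ∧ ¬ A z b ∧ ¬ A z c ∧ A z d ∧ A z e) (hxy : A x y) : False := by
  have hs := hF.symm
  have h1 := hF.p3p2 a e c x y
  have h2 := hF.ft z a y b c e
  have h3 := hF.w4 a e d y z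
  obtain ⟨_, _, _, _, _, _, _, _, _, _, _, _, _⟩ := hg
  obtain ⟨_, _, _, _, _⟩ := hx
  obtain ⟨_, _, _, _, _⟩ := hy
  obtain ⟨_, _, _, _, _⟩ := hz
  grind

/-- The non-neighbours of an edge induce a graph of maximum degree at most one. -/
theorem matching (hF : FreeHyp A) {p q x y z : V} (hpq : A p q)
    (hx : ¬ A x p ∧ ¬ A x q) (hy : ¬ A y p ∧ ¬ A y q) (hz : ¬ A z p ∧ ¬ A z q)
    (hxy : A x y) (hxz : A x z) : y = z := by
  have hs := hF.symm
  by_contra hne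
  have h1 := hF.p3p2 y x z p q
  have h2 := hF.p2k3 p q x y z
  grind

/-- A set inducing a graph of maximum degree at most one is 2-colourable. -/
theorem two_col [Finite V] (hF : FreeHyp A) (S : V → Prop)
    (h : ∀ x y z, S x → S y → S z → A x y → A x z → y = z) :
    ∃ m : V → Prop, ∀ x y, S x → S y → A x y → ¬ (m x ↔ m y) := by
  classical
  obtain ⟨n, ⟨f⟩⟩ := Finite.exists_equiv_fin V
  refine ⟨fun x => ∃ y, S y ∧ A x y ∧ f y < f x, fun x y hx hy hxy => ?_⟩
  have hyx := hF.symm _ _ hxy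
  have key : ∀ u v, S u → S v → A u v → ((∃ y, S y ∧ A u y ∧ f y < f u) ↔ f v < f u) := by
    intro u v hu hv huv
    constructor
    · rintro ⟨w, hw, huw, hlt⟩
      rwa [h u v w hu hv hw huv huw]
    · intro hlt
      exact ⟨v, hv, huv, hlt⟩
  have hne : f x ≠ f y := by
    intro hf
    have := f.injective hf
    subst this
    exact hF.irrefl _ hxy
  dsimp only
  rw [key x y hx hy hxy, key y x hy hx hyx]
  rcases lt_or_gt_of_ne hne with hlt | hlt
  · exact fun hh => absurd (hh.mpr hlt) (not_lt.mpr hlt.le)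
  · exact fun hh => absurd (hh.mp hlt) (not_lt.mpr hlt.le)

/-- Gluing: four stable sets and two 2-colourable sets give an 8-colouring. -/
theorem glue (S1 S2 S3 S4 S5 S6 m3 m6 : V → Prop)
    (hcov : ∀ x, S1 x ∨ S2 x ∨ S3 x ∨ S4 x ∨ S5 x ∨ S6 x)
    (h1 : ∀ x y, S1 x → S1 y → ¬ A x y) (h2 : ∀ x y, S2 x → S2 y → ¬ A x y)
    (h3 : ∀ x y, S3 x → S3 y → A x y → ¬ (m3 x ↔ m3 y))
    (h4 : ∀ x y, S4 x → S4 y → ¬ A x y) (h5 : ∀ x y, S5 x → S5 y → ¬ A x y)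
    (h6 : ∀ x y, S6 x → S6 y → A x y → ¬ (m6 x ↔ m6 y)) :
    ∃ f : V → Fin 8, ∀ x y, A x y → f x ≠ f y := by
  classical
  refine ⟨fun x => if S1 x then 0 else if S2 x then 1 else if S4 x then 2 else if S5 x then 3
    else if S3 x then (if m3 x then 4 else 5) else (if m6 x then 6 else 7), fun x y hxy => ?_⟩
  have hx := hcov x
  have hy := hcov y
  have := h1 x y
  have := h2 x y
  have := h3 x y
  have := h4 x y
  have := h5 x y
  have := h6 x y
  clear h1 h2 h3 h4 h5 h6 hcov
  dsimp only
  split_ifs <;> first | decide | grind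

/-- The class of types be, ce together with the gem vertices a, d. -/
def Cls3 (A : V → V → Prop) (a b c d e x : V) : Prop :=
  x = a ∨ x = d ∨ (Outside a b c d e x ∧ A x b ∧ A x e ∧ ¬ A x a ∧ ¬ A x c ∧ ¬ A x d) ∨
    (Outside a b c d e x ∧ A x c ∧ A x e ∧ ¬ A x a ∧ ¬ A x b ∧ ¬ A x d)

theorem cls3_edge (hF : FreeHyp A) {a b c d e x y : V} (hg : IsGem A a b c d e)
    (hx : Cls3 A a b c d e x) (hy : Cls3 A a b c d e y) (hxy : A x y) :
    (A x b ∧ ¬ A x c ∧ ¬ A x d ∧ ¬ A y c ∧ ¬ A y d) ∨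
    (¬ A x b ∧ ¬ A x a ∧ ¬ A y a ∧ ¬ A y b) := by
  have hs := hF.symm
  have hi := hF.irrefl
  have h1 := @cross34 V A hF a b c d e x y hg
  have h2 := @cross34 V A hF a b c d e y x hg
  obtain ⟨_, _, _, _, _, _, _, _, _, _, _, _, _⟩ := hg
  unfold Cls3 at hx hy
  grind

theorem cls3_matching (hF : FreeHyp A) {a b c d e x y z : V} (hg : IsGem A a b c d e)
    (hx : Cls3 A a b c d e x) (hy : Cls3 A a b c d e y) (hz : Cls3 A a b c d e z)
    (hxy : A x y) (hxz : A x z) : y = z := by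
  have e1 := cls3_edge hF hg hx hy hxy
  have e2 := cls3_edge hF hg hx hz hxz
  have k1 := fun p q r => matching hF hg.cd p q r hxy hxz
  have k2 := fun p q r => matching hF hg.ab p q r hxy hxz
  tauto

/-- The colouring, with the last two classes (three colours) left as parameters. -/
theorem assemble [Finite V] (hF : FreeHyp A) {a b c d e : V} (hg : IsGem A a b c d e)
    (S5 S6 : V → Prop) (he : S5 e)
    (hcov : ∀ x, Outside a b c d e x →
      ((A x b ∧ ¬ A x c ∧ ¬ A x e ∧ (A x a → A x d)) ∨
       (A x a ∧ ¬ A x b ∧ ¬ A x e ∧ (A x c ∨ A x d)) ∨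
       (A x a ∧ ¬ A x b ∧ ¬ A x c ∧ A x d ∧ A x e)) → S5 x ∨ S6 x)
    (h5 : ∀ x y, S5 x → S5 y → ¬ A x y)
    (h6 : ∀ x y z, S6 x → S6 y → S6 z → A x y → A x z → y = z) :
    ∃ f : V → Fin 8, ∀ x y, A x y → f x ≠ f y := by
  obtain ⟨m3, hm3⟩ := two_col hF (Cls3 A a b c d e)
    (fun x y z hx hy hz => cls3_matching hF hg hx hy hz)
  obtain ⟨m6, hm6⟩ := two_col hF S6 h6
  refine glue
    (fun x => x = c ∨ (Outside a b c d e x ∧ ¬ A x c ∧ ¬ A x d ∧ (A x a ∨ ¬ A x b)))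
    (fun x => x = b ∨ (Outside a b c d e x ∧ ¬ A x a ∧ ¬ A x b ∧ (A x d ∨ (A x c ∧ ¬ A x e))))
    (Cls3 A a b c d e)
    (fun x => Outside a b c d e x ∧ A x b ∧ A x c ∧ A x e) S5 S6 m3 m6
    ?_ ?_ ?_ hm3 ?_ h5 hm6
  · intro x
    by_cases hx : Outside a b c d e x
    · have h1 := hcov x hx
      have h2 := excl hF hg hx
      unfold Cls3
      clear hcov h5 h6 hm3 hm6 hF hg
      grind
    · unfold Cls3
      unfold Outside at hx ⊢
      clear hcov h5 h6 hm3 hm6 hF hg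
      grind
  · rintro x y (rfl | ⟨hx, tx⟩) (rfl | ⟨hy, ty⟩)
    · exact hF.irrefl _
    · exact fun k => ty.1 (hF.symm _ _ k)
    · exact tx.1
    · exact stab1 hF hg hx hy tx ty
  · rintro x y (rfl | ⟨hx, tx⟩) (rfl | ⟨hy, ty⟩)
    · exact hF.irrefl _
    · exact fun k => ty.2.1 (hF.symm _ _ k)
    · exact tx.2.1
    · exact stab2 hF hg hx hy tx ty
  · rintro x y ⟨hx, tx⟩ ⟨hy, ty⟩
    exact stab5 hF hg tx ty

/-- Case A: types b, bd, abd form a stable set. -/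
theorem caseA [Finite V] (hF : FreeHyp A) {a b c d e : V} (hg : IsGem A a b c d e)
    (hst : ∀ x y, Outside a b c d e x → Outside a b c d e y →
      (A x b ∧ ¬ A x c ∧ ¬ A x e ∧ (A x a → A x d)) →
      (A y b ∧ ¬ A y c ∧ ¬ A y e ∧ (A y a → A y d)) → ¬ A x y) :
    ∃ f : V → Fin 8, ∀ x y, A x y → f x ≠ f y := by
  refine assemble hF hg
    (fun x => x = e ∨ (Outside a b c d e x ∧ (A x b ∧ ¬ A x c ∧ ¬ A x e ∧ (A x a → A x d))))
    (fun x => Outside a b c d e x ∧ ((A x a ∧ ¬ A x b ∧ ¬ A x e ∧ (A x c ∨ A x d)) ∨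
       (A x a ∧ ¬ A x b ∧ ¬ A x c ∧ A x d ∧ A x e))) (Or.inl rfl) ?_ ?_ ?_
  · intro x hx h
    tauto
  · rintro x y (rfl | ⟨hx, tx⟩) (rfl | ⟨hy, ty⟩)
    · exact hF.irrefl _
    · exact fun k => ty.2.2.1 (hF.symm _ _ k)
    · exact tx.2.2.1
    · exact hst x y hx hy tx ty
  · rintro x y z ⟨hx, tx⟩ ⟨hy, ty⟩ ⟨hz, tz⟩ hxy hxz
    have k1 := fun p q r => matching hF hg.eb p q r hxy hxz
    have k2 := fun p q r => matching hF hg.bc p q r hxy hxz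
    have c1 := fun p q => cross7 hF hg hx hy p q hxy
    have c2 := fun p q => cross7 hF hg hx hz p q hxz
    have c3 := fun p q => cross7 hF hg hy hx p q (hF.symm _ _ hxy)
    have c4 := fun p q => cross7 hF hg hz hx p q (hF.symm _ _ hxz)
    rcases tx with tx | tx <;> rcases ty with ty | ty <;> rcases tz with tz | tz <;>
      first
      | exact (c1 tx ty).elim
      | exact (c2 tx tz).elim
      | exact (c3 ty tx).elim
      | exact (c4 tz tx).elim
      | exact k1 ⟨tx.2.2.1, tx.2.1⟩ ⟨ty.2.2.1, ty.2.1⟩ ⟨tz.2.2.1, tz.2.1⟩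
      | exact k2 ⟨tx.2.1, tx.2.2.1⟩ ⟨ty.2.1, ty.2.2.1⟩ ⟨tz.2.1, tz.2.2.1⟩

/-- Case C: there is no vertex of type ade, and types ac, acd form a stable set. -/
theorem caseC [Finite V] (hF : FreeHyp A) {a b c d e : V} (hg : IsGem A a b c d e)
    (hno : ∀ x, Outside a b c d e x → ¬ (A x a ∧ ¬ A x b ∧ ¬ A x c ∧ A x d ∧ A x e))
    (hst : ∀ x y, Outside a b c d e x → Outside a b c d e y →
      (A x a ∧ ¬ A x b ∧ A x c ∧ ¬ A x e) → (A y a ∧ ¬ A y b ∧ A y c ∧ ¬ A y e) → ¬ A x y) :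
    ∃ f : V → Fin 8, ∀ x y, A x y → f x ≠ f y := by
  refine assemble hF hg
    (fun x => x = e ∨ (Outside a b c d e x ∧ (A x a ∧ ¬ A x b ∧ A x c ∧ ¬ A x e)))
    (fun x => ¬ A x c ∧ ¬ A x e) (Or.inl rfl) ?_ ?_ ?_
  · intro x hx h
    have := hno x hx
    tauto
  · rintro x y (rfl | ⟨hx, tx⟩) (rfl | ⟨hy, ty⟩)
    · exact hF.irrefl _
    · exact fun k => ty.2.2.2 (hF.symm _ _ k)
    · exact tx.2.2.2
    · exact hst x y hx hy tx ty
  · intro x y z hx hy hz hxy hxz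
    exact matching hF hg.ec hx.symm hy.symm hz.symm hxy hxz

theorem Outside.flip {a b c d e x : V} (h : Outside a b c d e x) : Outside d c b a e x :=
  ⟨h.2.2.2.1, h.2.2.1, h.2.1, h.1, h.2.2.2.2⟩

theorem main_col [Finite V] (hF : FreeHyp A) {a b c d e : V} (hg : IsGem A a b c d e) :
    ∃ f : V → Fin 8, ∀ x y, A x y → f x ≠ f y := by
  by_cases hA : ∀ x y, Outside a b c d e x → Outside a b c d e y →
      (A x b ∧ ¬ A x c ∧ ¬ A x e ∧ (A x a → A x d)) →
      (A y b ∧ ¬ A y c ∧ ¬ A y e ∧ (A y a → A y d)) → ¬ A x y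
  · exact caseA hF hg hA
  push Not at hA
  obtain ⟨x, y, hx, hy, tx, ty, hxy⟩ := hA
  by_cases hno : ∀ x, Outside a b c d e x → ¬ (A x a ∧ ¬ A x b ∧ ¬ A x c ∧ A x d ∧ A x e)
  · exact caseC hF hg hno
      (fun z w hz hw tz tw hzw => dich hF hg hx hy hz hw tx ty tz tw hxy hzw)
  push Not at hno
  obtain ⟨u, hu, tu⟩ := hno
  have n1 := fun p => noade hF hg hx hy hu p ty tu hxy
  have n2 := fun p => noade hF hg hy hx hu p tx tu (hF.symm _ _ hxy)
  refine caseA hF (hg.flip hF) (fun z w hz hw tz tw hzw => ?_)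
  refine dich hF (hg.flip hF) hz hw hx.flip hy.flip tz tw ?_ ?_ hzw hxy
  · tauto
  · tauto

end core

set_option maxHeartbeats 4000000 in
theorem stmt9 {V : Type*} [Fintype V] (G : SimpleGraph V)
    (hP : IsEmpty (P3P2 ↪g G)) (hW : IsEmpty (W4 ↪g G)) (hK5 : G.CliqueFree 5)
    (hP2K3 : IsEmpty (P2K3 ↪g G)) (h4T : IsEmpty (fourTriangle ↪g G))
    (hQ : Nonempty (gem ↪g G)) :
    G.chromaticNumber ≤ 8 := by
  have key : ∀ {n : ℕ} {H : SimpleGraph (Fin n)}, IsEmpty (H ↪g G) → ∀ f : Fin n → V,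
      Function.Injective f → (∀ i j, G.Adj (f i) (f j) ↔ H.Adj i j) → False :=
    fun h f hf hadj => h.false ⟨⟨f, hf⟩, fun {i j} => hadj i j⟩
  have hF : FreeHyp G.Adj := by
    have hs : ∀ u v, G.Adj u v → G.Adj v u := fun u v h => h.symm
    have hi : ∀ u, ¬ G.Adj u u := fun u => G.irrefl
    refine ⟨hs, hi, ?_, ?_, ?_, ?_, ?_⟩
    · intro p q r s t
      intros
      refine key hP ![p, q, r, s, t] ?_ ?_
      · intro i j
        fin_cases i <;> fin_cases j <;> simp <;> grind
      · intro i j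
        fin_cases i <;> fin_cases j <;> simp [P3P2] <;> grind
    · intro p q r s t
      intros
      refine key hW ![p, q, r, s, t] ?_ ?_
      · intro i j
        fin_cases i <;> fin_cases j <;> simp <;> grind
      · intro i j
        fin_cases i <;> fin_cases j <;> simp [W4] <;> grind
    · intro p q r s t
      intros
      have hK : IsEmpty ((completeGraph (Fin 5)) ↪g G) :=
        ⟨fun φ => (cliqueFree_iff.mp hK5).false φ.toCopy⟩
      refine key hK ![p, q, r, s, t] ?_ ?_
      · intro i j
        fin_cases i <;> fin_cases j <;> simp <;> grind
      · intro i j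
        fin_cases i <;> fin_cases j <;> simp <;> grind
    · intro p q r s t
      intros
      refine key hP2K3 ![p, q, r, s, t] ?_ ?_
      · intro i j
        fin_cases i <;> fin_cases j <;> simp <;> grind
      · intro i j
        fin_cases i <;> fin_cases j <;> simp [P2K3] <;> grind
    · intro p q r s t u
      intros
      refine key h4T ![p, q, r, s, t, u] ?_ ?_
      · intro i j
        fin_cases i <;> fin_cases j <;> simp <;> grind
      · intro i j
        fin_cases i <;> fin_cases j <;> simp [fourTriangle] <;> grind
  obtain ⟨φ⟩ := hQ
  have hadj : ∀ i j, G.Adj (φ i) (φ j) ↔ gem.Adj i j := fun i j => φ.map_adj_iff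
  have hinj := φ.injective
  have hg : IsGem G.Adj (φ 0) (φ 1) (φ 2) (φ 3) (φ 4) := by
    constructor <;> first | (rw [hadj]; simp [gem]) | (rw [hinj.ne_iff]; decide)
  obtain ⟨f, hf⟩ := main_col hF hg
  have hc : G.Colorable 8 := ⟨Coloring.mk f (fun {x y} h => hf x y h)⟩
  exact hc.chromaticNumber_le
end

section
/- Let G be a finite simple graph. If G is (P3∪P2)-free, W4-free and K4-free, then χ(G) ≤ 6. -/
open SimpleGraph

/-- First-order form of the three forbidden-subgraph hypotheses. -/
structure FO {V : Type*} (G : SimpleGraph V) : Prop where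
  p : ∀ a b c d e, G.Adj a b → G.Adj b c → a ≠ c → ¬ G.Adj a c → G.Adj d e →
    ¬ G.Adj a d → ¬ G.Adj a e → ¬ G.Adj b d → ¬ G.Adj b e → ¬ G.Adj c d → ¬ G.Adj c e → False
  w : ∀ a b c d h, G.Adj a b → G.Adj b c → G.Adj c d → G.Adj d a → a ≠ c → b ≠ d →
    ¬ G.Adj a c → ¬ G.Adj b d → G.Adj h a → G.Adj h b → G.Adj h c → G.Adj h d → False
  k : ∀ a b c d, G.Adj a b → G.Adj a c → G.Adj a d → G.Adj b c → G.Adj b d → G.Adj c d → False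

theorem FO.of {V : Type*} (G : SimpleGraph V)
    (hP : IsEmpty (P3P2 ↪g G)) (hW : IsEmpty (W4 ↪g G)) (hK4 : G.CliqueFree 4) : FO G := by
  refine ⟨?_, ?_, ?_⟩
  · intro a b c d e hab hbc hne hac hde had hae hbd hbe hcd hce
    refine hP.false ⟨⟨![a, b, c, d, e], ?_⟩, ?_⟩
    · have := hab.ne; have := hbc.ne; have := hde.ne
      have : a ≠ d := by rintro rfl; exact hae hde
      have : a ≠ e := by rintro rfl; exact had hde.symm
      have : b ≠ d := by rintro rfl; exact hbe hde
      have : b ≠ e := by rintro rfl; exact hbd hde.symm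
      have : c ≠ d := by rintro rfl; exact hce hde
      have : c ≠ e := by rintro rfl; exact hcd hde.symm
      intro i j hij
      fin_cases i <;> fin_cases j <;> simp_all
    · intro i j
      have := G.adj_comm
      change G.Adj (![a, b, c, d, e] i) (![a, b, c, d, e] j) ↔ _
      fin_cases i <;> fin_cases j <;> simp [P3P2] <;> grind
  · intro a b c d h hab hbc hcd hda hac hbd nac nbd ha hb hc hd
    refine hW.false ⟨⟨![a, b, c, d, h], ?_⟩, ?_⟩
    · have := hab.ne; have := hbc.ne; have := hcd.ne; have := hda.ne
      have := ha.ne; have := hb.ne; have := hc.ne; have := hd.ne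
      intro i j hij
      fin_cases i <;> fin_cases j <;> simp_all
    · intro i j
      have := G.adj_comm
      change G.Adj (![a, b, c, d, h] i) (![a, b, c, d, h] j) ↔ _
      fin_cases i <;> fin_cases j <;> simp [W4] <;> grind
  · intro a b c d h1 h2 h3 h4 h5 h6
    classical
    refine hK4 {a, b, c, d} ?_
    rw [SimpleGraph.isNClique_iff]
    refine ⟨?_, ?_⟩
    · have := G.adj_comm
      intro x hx y hy hxy
      simp only [Finset.coe_insert, Finset.coe_singleton, Set.mem_insert_iff,
        Set.mem_singleton_iff] at hx hy
      grind
    · have := h1.ne; have := h2.ne; have := h3.ne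
      have := h4.ne; have := h5.ne; have := h6.ne
      grind

/-- Cover by six stable sets, plus a stable set `M` each of whose vertices misses one of the six. -/
theorem cover {V : Type*} (G : SimpleGraph V) (S : Fin 6 → V → Prop) (M : V → Prop)
    (hS : ∀ i x y, S i x → S i y → ¬ G.Adj x y)
    (hM : ∀ x y, M x → M y → ¬ G.Adj x y)
    (hc : ∀ v, M v ∨ ∃ i, S i v)
    (hm : ∀ m, M m → ∃ i, ∀ x, S i x → ¬ G.Adj m x) : G.Colorable 6 := by
  classical
  have h : ∀ v, ∃ i, (M v ∧ ∀ x, S i x → ¬ G.Adj v x) ∨ (¬ M v ∧ S i v) := by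
    intro v
    by_cases hv : M v
    · obtain ⟨i, hi⟩ := hm v hv; exact ⟨i, Or.inl ⟨hv, hi⟩⟩
    · obtain ⟨i, hi⟩ := (hc v).resolve_left hv; exact ⟨i, Or.inr ⟨hv, hi⟩⟩
  choose f hf using h
  refine ⟨SimpleGraph.Coloring.mk f ?_⟩
  intro u v huv he
  have h1 := hf u
  have h2 := hf v
  rw [he] at h1
  rcases h1 with ⟨a, b⟩ | ⟨a, b⟩ <;> rcases h2 with ⟨c, d⟩ | ⟨c, d⟩
  · exact hM _ _ a c huv
  · exact b _ d huv
  · exact d _ b huv.symm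
  · exact hS _ _ _ b d huv

/-- A set inducing a disjoint union of cliques of size at most 3 is covered by 3 stable sets. -/
theorem split3 {V : Type*} (G : SimpleGraph V) (H : V → Prop)
    (hp : ∀ x y z, H x → H y → H z → G.Adj x y → G.Adj y z → x ≠ z → G.Adj x z)
    (hk : ∀ a b c d, G.Adj a b → G.Adj a c → G.Adj a d → G.Adj b c → G.Adj b d → G.Adj c d → False) :
    ∃ D : Fin 3 → V → Prop, (∀ i x, D i x → H x) ∧ (∀ x, H x → ∃ i, D i x) ∧
      ∀ i x y, D i x → D i y → ¬ G.Adj x y := by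
  classical
  let _ : LinearOrder V := WellOrderingRel.isWellOrder.linearOrder
  let D2 : V → Prop := fun x => ∃ y z, H y ∧ H z ∧ z < y ∧ y < x ∧ G.Adj z y ∧ G.Adj y x ∧ G.Adj z x
  let D1 : V → Prop := fun x => ∃ y, H y ∧ y < x ∧ G.Adj y x
  refine ⟨![fun x => H x ∧ ¬ D2 x ∧ ¬ D1 x, fun x => H x ∧ ¬ D2 x ∧ D1 x, fun x => H x ∧ D2 x],
    ?_, ?_, ?_⟩
  · intro i x h
    fin_cases i <;> exact h.1
  · intro x hx
    by_cases h2 : D2 x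
    · exact ⟨2, hx, h2⟩
    by_cases h1 : D1 x
    · exact ⟨1, hx, h2, h1⟩
    · exact ⟨0, hx, h2, h1⟩
  · intro i x y hx hy hxy
    wlog hlt : x < y generalizing x y
    · exact this y x hy hx hxy.symm (lt_of_le_of_ne (not_lt.mp hlt) hxy.ne.symm)
    fin_cases i
    · exact hy.2.2 ⟨x, hx.1, hlt, hxy⟩
    · obtain ⟨z, hz, hzx, hzz⟩ := hx.2.2
      exact hy.2.1 ⟨x, z, hx.1, hz, hzx, hlt, hzz, hxy,
        hp _ _ _ hz hx.1 hy.1 hzz hxy (hzx.trans hlt).ne⟩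
    · obtain ⟨y', z, hy', hz, h1, h2, h3, h4, h5⟩ := hx.2
      exact hk z y' x y h3 h5 (hp _ _ _ hz hx.1 hy.1 h5 hxy ((h1.trans h2).trans hlt).ne) h4
        (hp _ _ _ hy' hx.1 hy.1 h4 hxy (h2.trans hlt).ne) hxy

/-- A set inducing a matching is covered by 2 stable sets. -/
theorem split2 {V : Type*} (G : SimpleGraph V) (H : V → Prop)
    (hp : ∀ x y z, H x → H y → H z → G.Adj x y → G.Adj y z → x ≠ z → False) :
    ∃ D : V → Prop, ∀ x y, H x → H y → G.Adj x y → (D x ↔ ¬ D y) := by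
  classical
  let _ : LinearOrder V := WellOrderingRel.isWellOrder.linearOrder
  have key : ∀ x y, H x → H y → G.Adj x y → x < y →
      ((∃ z, H z ∧ z < x ∧ G.Adj z x) ↔ ¬ (∃ z, H z ∧ z < y ∧ G.Adj z y)) := by
    intro x y hx hy hxy hlt
    constructor
    · rintro ⟨z, hz, hzx, h⟩
      exact (hp z x y hz hx hy h hxy (hzx.trans hlt).ne).elim
    · intro h
      exact (h ⟨x, hx, hlt, hxy⟩).elim
  refine ⟨fun x => ∃ z, H z ∧ z < x ∧ G.Adj z x, ?_⟩
  intro x y hx hy hxy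
  rcases lt_or_gt_of_ne hxy.ne with h | h
  · exact key x y hx hy hxy h
  · have := key y x hy hx hxy.symm h
    exact ⟨fun h1 h2 => this.1 h2 h1, fun h1 => by by_contra h2; exact h1 (this.2 h2)⟩

/-- Adjacent to `r` only. -/
def AA {V : Type*} (G : SimpleGraph V) (r s t x : V) : Prop :=
  G.Adj r x ∧ ¬ G.Adj s x ∧ ¬ G.Adj t x

/-- Nonadjacent to `r` only. -/
def BB {V : Type*} (G : SimpleGraph V) (r s t x : V) : Prop :=
  x ≠ r ∧ ¬ G.Adj r x ∧ G.Adj s x ∧ G.Adj t x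

/-- Adjacent to none. -/
def MM {V : Type*} (G : SimpleGraph V) (r s t x : V) : Prop :=
  ¬ G.Adj r x ∧ ¬ G.Adj s x ∧ ¬ G.Adj t x

/-- A triangle. -/
def TT {V : Type*} (G : SimpleGraph V) (r s t : V) : Prop :=
  G.Adj r s ∧ G.Adj s t ∧ G.Adj t r

section
variable {V : Type*} {G : SimpleGraph V} {r s t : V}

theorem TT.rot (h : TT G r s t) : TT G s t r := ⟨h.2.1, h.2.2, h.1⟩
theorem TT.swap (h : TT G r s t) : TT G r t s := ⟨h.2.2.symm, h.2.1.symm, h.1.symm⟩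
theorem AA.swap {x : V} (h : AA G r s t x) : AA G r t s x := ⟨h.1, h.2.2, h.2.1⟩
theorem BB.swap {x : V} (h : BB G r s t x) : BB G r t s x := ⟨h.1, h.2.1, h.2.2.2, h.2.2.1⟩
theorem MM.rot {x : V} (h : MM G r s t x) : MM G s t r x := ⟨h.2.1, h.2.2, h.1⟩
theorem MM.swap {x : V} (h : MM G r s t x) : MM G r t s x := ⟨h.1, h.2.2, h.2.1⟩

theorem classify (F : FO G) (T : TT G r s t) (x : V) :
    MM G r s t x ∨ AA G r s t x ∨ AA G s t r x ∨ AA G t r s x ∨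
    BB G r s t x ∨ BB G s t r x ∨ BB G t r s x ∨ x = r ∨ x = s ∨ x = t := by
  have := F.k r s t x T.1 T.2.2.symm
  have := T.2.1
  simp only [MM, AA, BB]
  tauto

theorem BB_self (F : FO G) (T : TT G r s t) {x y : V} (hx : BB G r s t x) (hy : BB G r s t y) :
    ¬ G.Adj x y := fun h =>
  F.k s t x y T.2.1 hx.2.2.1 hy.2.2.1 hx.2.2.2 hy.2.2.2 h

theorem BB_cross (F : FO G) (T : TT G r s t) {x y : V} (hx : BB G r s t x) (hy : BB G s t r y) :
    ¬ G.Adj x y := fun h =>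
  F.w r s x y t T.1 hx.2.2.1 h hy.2.2.2.symm hx.1.symm hy.1.symm hx.2.1 hy.2.1
    T.2.2 T.2.1.symm hx.2.2.2 hy.2.2.1

/-- `A_r ∪ M` induces a disjoint union of cliques. -/
theorem AM_p3 (F : FO G) (T : TT G r s t) {x y z : V}
    (hx : ¬ G.Adj s x ∧ ¬ G.Adj t x) (hy : ¬ G.Adj s y ∧ ¬ G.Adj t y)
    (hz : ¬ G.Adj s z ∧ ¬ G.Adj t z) (hxy : G.Adj x y) (hyz : G.Adj y z) (hne : x ≠ z) :
    G.Adj x z := by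
  by_contra h
  have := G.adj_comm
  exact F.p x y z s t hxy hyz hne h T.2.1 (by grind) (by grind) (by grind) (by grind)
    (by grind) (by grind)

theorem A_match (F : FO G) (T : TT G r s t) {x y z : V} (hx : AA G r s t x) (hy : AA G r s t y)
    (hz : AA G r s t z) (hxy : G.Adj x y) (hyz : G.Adj y z) (hne : x ≠ z) : False :=
  F.k r x y z hx.1 hy.1 hz.1 hxy (AM_p3 F T hx.2 hy.2 hz.2 hxy hyz hne) hyz

/-- An edge in `A_r` dominates whatever is adjacent to exactly one of `s`, `t`. -/
theorem edge_dom (F : FO G) (T : TT G r s t) {x y z : V} (hx : AA G r s t x) (hy : AA G r s t y)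
    (hxy : G.Adj x y) (hz : G.Adj s z) (hz' : ¬ G.Adj t z) (hne : z ≠ t) :
    G.Adj z x ∨ G.Adj z y := by
  by_contra h
  push Not at h
  have hc := G.adj_comm
  exact F.p z s t x y hz.symm T.2.1 hne (by grind) hxy h.1 h.2 hx.2.1 hy.2.1 hx.2.2 hy.2.2

/-- Vertices in `B_s` see exactly one end of each edge in `A_r`. -/
theorem B_edge (F : FO G) (T : TT G r s t) {x y b : V} (hx : AA G r s t x) (hy : AA G r s t y)
    (hxy : G.Adj x y) (hb : BB G s t r b) : G.Adj b x ↔ ¬ G.Adj b y := by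
  have h1 := edge_dom F T.swap hx.swap hy.swap hxy hb.2.2.1 hb.2.1 hb.1
  have h2 := F.k r x y b hx.1 hy.1 hb.2.2.2 hxy
  have hc := G.adj_comm
  grind

theorem B_edge' (F : FO G) (T : TT G r s t) {x y b : V} (hx : AA G r s t x) (hy : AA G r s t y)
    (hxy : G.Adj x y) (hb : BB G t r s b) : G.Adj b x ↔ ¬ G.Adj b y :=
  B_edge F T.swap hx.swap hy.swap hxy hb.swap

theorem A_dom (F : FO G) (T : TT G r s t) {x y z : V} (hx : AA G r s t x) (hy : AA G r s t y)
    (hxy : G.Adj x y) (hz : AA G s t r z) : G.Adj z x ∨ G.Adj z y := by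
  refine edge_dom F T hx hy hxy hz.1 hz.2.1 ?_
  rintro rfl
  exact hz.2.2 T.2.2.symm

theorem A_dom' (F : FO G) (T : TT G r s t) {x y z : V} (hx : AA G r s t x) (hy : AA G r s t y)
    (hxy : G.Adj x y) (hz : AA G t r s z) : G.Adj z x ∨ G.Adj z y :=
  A_dom F T.swap hx.swap hy.swap hxy hz.swap

/-- No vertex is complete to an edge in `A_r` and to an edge in `A_s`. -/
theorem two_edges (F : FO G) (T : TT G r s t) {m x y z w : V} (hx : AA G r s t x)
    (hy : AA G r s t y) (hz : AA G s t r z) (hw : AA G s t r w) (hxy : G.Adj x y)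
    (hzw : G.Adj z w) (mx : G.Adj m x) (my : G.Adj m y) (mz : G.Adj m z) (mw : G.Adj m w) :
    False := by
  have hc := G.adj_comm
  have h1 := A_dom F T hx hy hxy hz
  have h2 := A_dom F T hx hy hxy hw
  have h3 := A_dom' F T.rot hz hw hzw hx
  have h4 := A_dom' F T.rot hz hw hzw hy
  have k1 := F.k m x y z mx my mz hxy
  have k2 := F.k m x y w mx my mw hxy
  have n1 : x ≠ z := by rintro rfl; exact hz.2.2 hx.1
  have n2 : x ≠ w := by rintro rfl; exact hw.2.2 hx.1
  have n3 : y ≠ z := by rintro rfl; exact hz.2.2 hy.1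
  have n4 : y ≠ w := by rintro rfl; exact hw.2.2 hy.1
  have w1 := F.w x y w z m hxy
  have w2 := F.w x y z w m hxy
  grind

/-- If `m ∈ M` is complete to an edge of `A_r`, then it has no neighbour in `B_s`. -/
theorem edge_B (F : FO G) (T : TT G r s t) {m x y b : V} (hm : MM G r s t m)
    (hx : AA G r s t x) (hy : AA G r s t y) (hxy : G.Adj x y) (mx : G.Adj m x) (my : G.Adj m y)
    (hb : BB G s t r b) : ¬ G.Adj m b := by
  intro mb
  have key : ∀ x y, AA G r s t x → AA G r s t y → G.Adj x y → G.Adj m x → G.Adj m y →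
      G.Adj b x → False := by
    intro x y hx hy hxy mx my hbx
    have h := (B_edge F T hx hy hxy hb).1 hbx
    refine F.w r b m y x hb.2.2.2 mb.symm my hy.1.symm ?_ ?_ hm.1 h hx.1.symm hbx.symm mx.symm hxy
    · rintro rfl; exact hm.2.1 T.1.symm
    · rintro rfl; exact hy.2.2 hb.2.2.1
  have h := B_edge F T hx hy hxy hb
  by_cases hbx : G.Adj b x
  · exact key x y hx hy hxy mx my hbx
  · exact key y x hy hx hxy.symm my mx (by tauto)

theorem edge_B' (F : FO G) (T : TT G r s t) {m x y b : V} (hm : MM G r s t m)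
    (hx : AA G r s t x) (hy : AA G r s t y) (hxy : G.Adj x y) (mx : G.Adj m x) (my : G.Adj m y)
    (hb : BB G t r s b) : ¬ G.Adj m b :=
  edge_B F T.swap hm.swap hx.swap hy.swap hxy mx my hb.swap

/-- Two neighbours of `m ∈ M` in `A_r` are adjacent. -/
theorem M_nbrs (F : FO G) (T : TT G r s t) {m x y : V} (hm : MM G r s t m)
    (hx : AA G r s t x) (hy : AA G r s t y) (mx : G.Adj m x) (my : G.Adj m y) (hne : x ≠ y) :
    G.Adj x y :=
  AM_p3 F T hx.2 hm.2 hy.2 mx.symm my hne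

/-- `m ∈ M` is complete or anticomplete to an edge of `A_r`. -/
theorem M_edge (F : FO G) (T : TT G r s t) {m x y : V} (hm : MM G r s t m)
    (hx : AA G r s t x) (hy : AA G r s t y) (hxy : G.Adj x y) (mx : G.Adj m x) : G.Adj m y := by
  refine AM_p3 F T hm.2 hx.2 hy.2 mx hxy ?_
  rintro rfl; exact hm.1 hy.1

/-- If `A_r`, `A_t` have edges `pq`, `zw` anticomplete to `m ∈ M`, then `m` has no neighbour
in `A_s`. -/
theorem M_iso (F : FO G) (T : TT G r s t) {m a p q z w : V} (hm : MM G r s t m)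
    (ha : AA G s t r a) (hp : AA G r s t p) (hq : AA G r s t q) (hz : AA G t r s z)
    (hw : AA G t r s w) (hpq : G.Adj p q) (hzw : G.Adj z w)
    (mp : ¬ G.Adj m p) (mq : ¬ G.Adj m q) (mz : ¬ G.Adj m z) (mw : ¬ G.Adj m w) :
    ¬ G.Adj m a := by
  intro mma
  have hc := G.adj_comm
  have key1 : ∀ p, AA G r s t p → ¬ G.Adj m p → G.Adj a p := by
    intro p hp mp
    by_contra h
    refine F.p p r t m a hp.1.symm T.2.2.symm ?_ ?_ mma ?_ ?_ hm.1 ha.2.2 hm.2.2 ha.2.1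
    · rintro rfl; exact hp.2.1 T.2.1
    · rw [hc]; exact hp.2.2
    · rw [hc]; exact mp
    · rw [hc]; exact h
  have key2 : ∀ z, AA G t r s z → ¬ G.Adj m z → G.Adj a z := by
    intro z hz mz
    by_contra h
    refine F.p z t r m a hz.1.symm T.2.2 ?_ ?_ mma ?_ ?_ hm.2.2 ha.2.1 hm.1 ha.2.2
    · rintro rfl; exact hz.2.2 T.1.symm
    · rw [hc]; exact hz.2.1
    · rw [hc]; exact mz
    · rw [hc]; exact h
  exact two_edges F T.rot.rot hz hw hp hq hzw hpq (key2 z hz mz) (key2 w hw mw) (key1 p hp mp)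
    (key1 q hq mq)

/-- `A_s ∪ B_r` splits into two stable sets. -/
theorem pair (F : FO G) (T : TT G r s t) : ∃ P Q : V → Prop, (∀ x, P x → ¬ Q x) ∧
    (∀ x, P x ∨ Q x ↔ AA G s t r x ∨ BB G r s t x) ∧
    (∀ x y, P x → P y → ¬ G.Adj x y) ∧ (∀ x y, Q x → Q y → ¬ G.Adj x y) := by
  have hc := G.adj_comm
  by_cases hB : ∃ b, BB G r s t b
  · obtain ⟨b, hb⟩ := hB
    have hAB : ∀ x, AA G s t r x → ¬ BB G r s t x := fun x h1 h2 => h1.2.1 h2.2.2.2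
    have hBB : ∀ x y, BB G r s t x → BB G r s t y → ¬ G.Adj x y := fun x y => BB_self F T
    have hAA : ∀ x y, AA G s t r x → AA G s t r y → G.Adj x y → (G.Adj b x ↔ ¬ G.Adj b y) :=
      fun x y hx hy hxy => B_edge' F T.rot hx hy hxy hb
    have hone : ∀ x c, AA G s t r x → BB G r s t c → c ≠ b → G.Adj b x → ¬ G.Adj c x := by
      intro x c hx hcc hne h1 h2
      refine F.w x b t c s h1.symm hb.2.2.2.symm hcc.2.2.2 h2 ?_ hne.symm ?_ (hBB _ _ hb hcc)
        hx.1 hb.2.2.1 T.2.1 hcc.2.2.1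
      · rintro rfl; exact hx.2.2 T.2.2.symm
      · rw [hc]; exact hx.2.1
    refine ⟨fun x => (AA G s t r x ∧ G.Adj b x) ∨ (BB G r s t x ∧ x ≠ b),
      fun x => (AA G s t r x ∧ ¬ G.Adj b x) ∨ (BB G r s t x ∧ x = b), ?_, ?_, ?_, ?_⟩
    · intro x; have := hAB x; tauto
    · intro x; tauto
    · rintro x y (⟨h1, h2⟩ | ⟨h1, h2⟩) (⟨h3, h4⟩ | ⟨h3, h4⟩) h
      · have := hAA x y h1 h3 h; tauto
      · exact hone x y h1 h3 h4 h2 h.symm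
      · exact hone y x h3 h1 h2 h4 h
      · exact hBB _ _ h1 h3 h
    · rintro x y (⟨h1, h2⟩ | ⟨h1, h2⟩) (⟨h3, h4⟩ | ⟨h3, h4⟩) h
      · have := hAA x y h1 h3 h; tauto
      · subst h4; exact h2 h.symm
      · subst h2; exact h4 h
      · exact hBB _ _ h1 h3 h
  · obtain ⟨D, hD⟩ := split2 G (AA G s t r) (fun x y z hx hy hz => A_match F T.rot hx hy hz)
    push Not at hB
    refine ⟨fun x => AA G s t r x ∧ D x, fun x => AA G s t r x ∧ ¬ D x, ?_, ?_, ?_, ?_⟩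
    · intro x; tauto
    · intro x; have := hB x; tauto
    · rintro x y ⟨h1, h2⟩ ⟨h3, h4⟩ h
      have := hD x y h1 h3 h; tauto
    · rintro x y ⟨h1, h2⟩ ⟨h3, h4⟩ h
      have := hD x y h1 h3 h; tauto

/-- All of `B` is stable. -/
theorem B_stable (F : FO G) (T : TT G r s t) {x y : V}
    (hx : BB G r s t x ∨ BB G s t r x ∨ BB G t r s x)
    (hy : BB G r s t y ∨ BB G s t r y ∨ BB G t r s y) : ¬ G.Adj x y := by
  have hc := G.adj_comm
  rcases hx with hx | hx | hx <;> rcases hy with hy | hy | hy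
  · exact BB_self F T hx hy
  · exact BB_cross F T hx hy
  · rw [hc]; exact BB_cross F T.rot.rot hy hx
  · rw [hc]; exact BB_cross F T hy hx
  · exact BB_self F T.rot hx hy
  · exact BB_cross F T.rot hx hy
  · exact BB_cross F T.rot.rot hx hy
  · rw [hc]; exact BB_cross F T.rot hy hx
  · exact BB_self F T.rot.rot hx hy

/-- Adding one vertex to a stable set. -/
theorem stable_add {P : V → Prop} {v : V} (hP : ∀ x y, P x → P y → ¬ G.Adj x y)
    (hv : ∀ x, P x → ¬ G.Adj v x) : ∀ x y, (P x ∨ x = v) → (P y ∨ y = v) → ¬ G.Adj x y := by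
  rintro x y (hx | rfl) (hy | rfl) h
  · exact hP _ _ hx hy h
  · exact hv _ hx h.symm
  · exact hv _ hy h
  · exact G.loopless.irrefl _ h

/-- The case where `M` has an edge. -/
theorem caseM (F : FO G) (T : TT G r s t) {x y : V} (hx : MM G r s t x) (hy : MM G r s t y)
    (hxy : G.Adj x y) : G.Colorable 6 := by
  have hc := G.adj_comm
  have adom : ∀ r s t, TT G r s t → MM G r s t x → MM G r s t y → ∀ a, AA G r s t a →
      G.Adj a x ∨ G.Adj a y := by
    intro r s t T hx hy a ha
    by_contra h
    push Not at h
    refine F.p a r s x y ha.1.symm T.1 ?_ ?_ hxy h.1 h.2 hx.1 hy.1 hx.2.1 hy.2.1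
    · rintro rfl; exact ha.2.2 T.2.1.symm
    · rw [hc]; exact ha.2.1
  have astab : ∀ r s t, TT G r s t → MM G r s t x → MM G r s t y → ∀ a b, AA G r s t a →
      AA G r s t b → ¬ G.Adj a b := by
    intro r s t T hx hy a b ha hb hab
    have nax : a ≠ x := by rintro rfl; exact hx.1 ha.1
    have nay : a ≠ y := by rintro rfl; exact hy.1 ha.1
    have nbx : b ≠ x := by rintro rfl; exact hx.1 hb.1
    have nby : b ≠ y := by rintro rfl; exact hy.1 hb.1
    have h1 := adom r s t T hx hy a ha
    have h2 := adom r s t T hx hy b hb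
    have e1 := @AM_p3 V G r s t F T a x y ha.2 hx.2 hy.2
    have e2 := @AM_p3 V G r s t F T a y x ha.2 hy.2 hx.2
    have e3 := @AM_p3 V G r s t F T b x y hb.2 hx.2 hy.2
    have e4 := @AM_p3 V G r s t F T b y x hb.2 hy.2 hx.2
    have k := F.k a b x y hab
    grind
  obtain ⟨D, hD1, hD2, hD3⟩ := split3 G (fun v => ¬ G.Adj s v ∧ ¬ G.Adj t v)
    (fun x y z hx hy hz => AM_p3 F T hx hy hz) F.k
  refine cover G ![fun v => D 0 v ∨ v = t, D 1, D 2,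
    fun v => AA G s t r v ∨ v = r, fun v => AA G t r s v ∨ v = s,
    fun v => BB G r s t v ∨ BB G s t r v ∨ BB G t r s v] (fun _ => False) ?_ (by simp) ?_ (by simp)
  · intro i
    fin_cases i
    · exact stable_add (hD3 0) (fun x hx => (hD1 0 x hx).2)
    · exact hD3 1
    · exact hD3 2
    · exact stable_add (astab _ _ _ T.rot hx.rot hy.rot) (fun x hx => hx.2.2)
    · exact stable_add (astab _ _ _ T.rot.rot hx.rot.rot hy.rot.rot) (fun x hx => hx.2.2)
    · exact fun x y => B_stable F T
  · intro v
    right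
    have hD : ¬ G.Adj s v ∧ ¬ G.Adj t v → ∃ i, (![fun v => D 0 v ∨ v = t, D 1, D 2,
        fun v => AA G s t r v ∨ v = r, fun v => AA G t r s v ∨ v = s,
        fun v => BB G r s t v ∨ BB G s t r v ∨ BB G t r s v] : Fin 6 → V → Prop) i v := by
      intro h
      obtain ⟨i, hi⟩ := hD2 v h
      fin_cases i
      · exact ⟨0, Or.inl hi⟩
      · exact ⟨1, hi⟩
      · exact ⟨2, hi⟩
    rcases classify F T v with h | h | h | h | h | h | h | h | h | h
    · exact hD h.2
    · exact hD h.2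
    · exact ⟨3, Or.inl h⟩
    · exact ⟨4, Or.inl h⟩
    · exact ⟨5, Or.inl h⟩
    · exact ⟨5, Or.inr (Or.inl h)⟩
    · exact ⟨5, Or.inr (Or.inr h)⟩
    · exact ⟨3, Or.inr h⟩
    · exact ⟨4, Or.inr h⟩
    · exact ⟨0, Or.inr h⟩

/-- First colouring scheme: one colour for `B`, two for `A_r`, three for `A_s ∪ A_t`. -/
theorem schemeI (F : FO G) (T : TT G r s t)
    (hM : ∀ x y, MM G r s t x → MM G r s t y → ¬ G.Adj x y)
    (K : Fin 3 → V → Prop) (hK : ∀ i x y, K i x → K i y → ¬ G.Adj x y)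
    (hsub : ∀ i x, K i x → AA G s t r x ∨ AA G t r s x)
    (hcov : ∀ x, AA G s t r x ∨ AA G t r s x → ∃ i, K i x)
    (hdis : ∀ i j x, K i x → K j x → i = j) : G.Colorable 6 := by
  obtain ⟨D, hD⟩ := split2 G (AA G r s t) (fun x y z hx hy hz => A_match F T hx hy hz)
  refine cover G ![fun v => (AA G r s t v ∧ D v) ∨ v = s, fun v => (AA G r s t v ∧ ¬ D v) ∨ v = t,
    fun v => K 0 v ∨ v = r, K 1, K 2, fun v => BB G r s t v ∨ BB G s t r v ∨ BB G t r s v]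
    (MM G r s t) ?_ hM ?_ ?_
  · intro i
    fin_cases i
    · refine stable_add (fun x y hx hy h => ?_) (fun x hx => hx.1.2.1)
      have := hD x y hx.1 hy.1 h
      tauto
    · refine stable_add (fun x y hx hy h => ?_) (fun x hx => hx.1.2.2)
      have := hD x y hx.1 hy.1 h
      tauto
    · refine stable_add (hK 0) (fun x hx => ?_)
      rcases hsub _ _ hx with h | h
      · exact h.2.2
      · exact h.2.1
    · exact hK 1
    · exact hK 2
    · exact fun x y => B_stable F T
  · intro v
    have hKK : AA G s t r v ∨ AA G t r s v → ∃ i, (![fun v => (AA G r s t v ∧ D v) ∨ v = s,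
        fun v => (AA G r s t v ∧ ¬ D v) ∨ v = t, fun v => K 0 v ∨ v = r, K 1, K 2,
        fun v => BB G r s t v ∨ BB G s t r v ∨ BB G t r s v] : Fin 6 → V → Prop) i v := by
      intro h
      obtain ⟨i, hi⟩ := hcov v h
      fin_cases i
      · exact ⟨2, Or.inl hi⟩
      · exact ⟨3, hi⟩
      · exact ⟨4, hi⟩
    rcases classify F T v with h | h | h | h | h | h | h | h | h | h
    · exact Or.inl h
    · right
      by_cases hd : D v
      · exact ⟨0, Or.inl ⟨h, hd⟩⟩
      · exact ⟨1, Or.inl ⟨h, hd⟩⟩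
    · exact Or.inr (hKK (Or.inl h))
    · exact Or.inr (hKK (Or.inr h))
    · exact Or.inr ⟨5, Or.inl h⟩
    · exact Or.inr ⟨5, Or.inr (Or.inl h)⟩
    · exact Or.inr ⟨5, Or.inr (Or.inr h)⟩
    · exact Or.inr ⟨2, Or.inr h⟩
    · exact Or.inr ⟨0, Or.inr h⟩
    · exact Or.inr ⟨1, Or.inr h⟩
  · intro m hm
    by_contra hcon
    push Not at hcon
    have hc := G.adj_comm
    obtain ⟨x0, h0, m0⟩ := hcon 0
    obtain ⟨x1, h1, m1⟩ := hcon 1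
    obtain ⟨x2, h2, m2⟩ := hcon 2
    obtain ⟨x3, h3, m3⟩ := hcon 3
    obtain ⟨x4, h4, m4⟩ := hcon 4
    replace h0 : AA G r s t x0 ∧ D x0 := h0.resolve_right (by
      rintro rfl; exact hm.2.1 m0.symm)
    replace h1 : AA G r s t x1 ∧ ¬ D x1 := h1.resolve_right (by
      rintro rfl; exact hm.2.2 m1.symm)
    replace h2 : K 0 x2 := h2.resolve_right (by
      rintro rfl; exact hm.1 m2.symm)
    change K 1 x3 at h3
    change K 2 x4 at h4
    have n01 : x0 ≠ x1 := by rintro rfl; exact h1.2 h0.2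
    have n23 : x2 ≠ x3 := by rintro rfl; exact absurd (hdis _ _ _ h2 h3) (by decide)
    have n24 : x2 ≠ x4 := by rintro rfl; exact absurd (hdis _ _ _ h2 h4) (by decide)
    have n34 : x3 ≠ x4 := by rintro rfl; exact absurd (hdis _ _ _ h3 h4) (by decide)
    have e01 := M_nbrs F T hm h0.1 h1.1 m0 m1 n01
    have key : ∀ x y, x ≠ y → G.Adj m x → G.Adj m y → AA G s t r x → AA G s t r y → False := by
      intro x y hne mx my hx hy
      exact two_edges F T h0.1 h1.1 hx hy e01 (M_nbrs F T.rot hm.rot hx hy mx my hne) m0 m1 mx my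
    have key' : ∀ x y, x ≠ y → G.Adj m x → G.Adj m y → AA G t r s x → AA G t r s y → False := by
      intro x y hne mx my hx hy
      exact two_edges F T.rot.rot hx hy h0.1 h1.1
        (M_nbrs F T.rot.rot hm.rot.rot hx hy mx my hne) e01 mx my m0 m1
    rcases hsub _ _ h2 with a2 | a2 <;> rcases hsub _ _ h3 with a3 | a3 <;>
      rcases hsub _ _ h4 with a4 | a4
    · exact key _ _ n23 m2 m3 a2 a3
    · exact key _ _ n23 m2 m3 a2 a3
    · exact key _ _ n24 m2 m4 a2 a4
    · exact key' _ _ n34 m3 m4 a3 a4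
    · exact key _ _ n34 m3 m4 a3 a4
    · exact key' _ _ n24 m2 m4 a2 a4
    · exact key' _ _ n23 m2 m3 a2 a3
    · exact key' _ _ n23 m2 m3 a2 a3

theorem A_disj {x : V} (h1 : AA G s t r x) (h2 : AA G t r s x) : False := h1.2.1 h2.1

/-- The case where `A_t` is stable. -/
theorem caseStable (F : FO G) (T : TT G r s t)
    (hM : ∀ x y, MM G r s t x → MM G r s t y → ¬ G.Adj x y)
    (hA : ∀ x y, AA G t r s x → AA G t r s y → ¬ G.Adj x y) : G.Colorable 6 := by
  obtain ⟨D, hD⟩ := split2 G (AA G s t r) (fun x y z hx hy hz => A_match F T.rot hx hy hz)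
  refine schemeI F T hM ![fun x => AA G s t r x ∧ D x, fun x => AA G s t r x ∧ ¬ D x, AA G t r s]
    ?_ ?_ ?_ ?_
  · intro i
    fin_cases i
    · intro x y hx hy h
      have := hD x y hx.1 hy.1 h
      have := hx.2; have := hy.2
      tauto
    · intro x y hx hy h
      have := hD x y hx.1 hy.1 h
      have := hx.2; have := hy.2
      tauto
    · exact hA
  · intro i x h
    fin_cases i
    · exact Or.inl h.1
    · exact Or.inl h.1
    · exact Or.inr h
  · rintro x (h | h)
    · by_cases hd : D x
      · exact ⟨0, h, hd⟩
      · exact ⟨1, h, hd⟩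
    · exact ⟨2, h⟩
  · intro i j x hi hj
    fin_cases i <;> fin_cases j <;> first | rfl | exfalso
    · exact hj.2 hi.2
    · exact A_disj hi.1 hj
    · exact hi.2 hj.2
    · exact A_disj hi.1 hj
    · exact A_disj hj.1 hi
    · exact A_disj hj.1 hi

/-- The case where some `m ∈ M` without neighbours in `A` has two neighbours in `B_r`. -/
theorem caseBad (F : FO G) (T : TT G r s t)
    (hM : ∀ x y, MM G r s t x → MM G r s t y → ¬ G.Adj x y) {m b c : V}
    (hb : BB G r s t b) (hc : BB G r s t c) (hbc : b ≠ c) (mb : G.Adj m b) (mc : G.Adj m c)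
    (hm : ∀ x, AA G s t r x ∨ AA G t r s x → ¬ G.Adj m x) : G.Colorable 6 := by
  have hcm := G.adj_comm
  -- edges inside `A_s` or inside `A_t`
  have hin : ∀ d, BB G r s t d → ∀ x y, (AA G s t r x ∧ AA G s t r y ∨ AA G t r s x ∧ AA G t r s y)
      → G.Adj x y → (G.Adj d x ↔ ¬ G.Adj d y) := by
    rintro d hd x y (⟨hx, hy⟩ | ⟨hx, hy⟩) h
    · exact B_edge' F T.rot hx hy h hd
    · exact B_edge F T.rot.rot hx hy h hd
  have hcr : ∀ d, BB G r s t d → ∀ x y, AA G s t r x → AA G t r s y → G.Adj d x → G.Adj d y →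
      ¬ G.Adj x y := by
    intro d hd x y hx hy dx dy h
    refine F.w s x y t d hx.1 h hy.1.symm T.2.1.symm ?_ ?_ hy.2.2 ?_ hd.2.2.1.symm dx dy
      hd.2.2.2.symm
    · rintro rfl; exact hy.2.1 T.1
    · rintro rfl; exact hx.2.2 T.2.2.symm
    · rw [hcm]; exact hx.2.1
  have hst : ∀ d, BB G r s t d → ∀ x y, (AA G s t r x ∨ AA G t r s x) →
      (AA G s t r y ∨ AA G t r s y) → G.Adj d x → G.Adj d y → ¬ G.Adj x y := by
    rintro d hd x y (hx | hx) (hy | hy) dx dy h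
    · exact (hin d hd x y (Or.inl ⟨hx, hy⟩) h).1 dx dy
    · exact hcr d hd x y hx hy dx dy h
    · exact hcr d hd y x hy hx dy dx h.symm
    · exact (hin d hd x y (Or.inr ⟨hx, hy⟩) h).1 dx dy
  have hX : ∀ x y, (AA G s t r x ∨ AA G t r s x) → (AA G s t r y ∨ AA G t r s y) →
      ¬ G.Adj b x → ¬ G.Adj b y → ¬ G.Adj c x → ¬ G.Adj c y → ¬ G.Adj x y := by
    intro x y hx hy bx b_y cx cy h
    exact F.p b m c x y mb.symm mc hbc (BB_self F T hb hc) h bx b_y (hm x hx) (hm y hy) cx cy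
  refine schemeI F T hM ![fun x => (AA G s t r x ∨ AA G t r s x) ∧ G.Adj b x,
    fun x => (AA G s t r x ∨ AA G t r s x) ∧ ¬ G.Adj b x ∧ G.Adj c x,
    fun x => (AA G s t r x ∨ AA G t r s x) ∧ ¬ G.Adj b x ∧ ¬ G.Adj c x] ?_ ?_ ?_ ?_
  · intro i x y hx hy
    fin_cases i
    · exact hst b hb x y hx.1 hy.1 hx.2 hy.2
    · exact hst c hc x y hx.1 hy.1 hx.2.2 hy.2.2
    · exact hX x y hx.1 hy.1 hx.2.1 hy.2.1 hx.2.2 hy.2.2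
  · intro i x h
    fin_cases i <;> exact h.1
  · intro x h
    by_cases h1 : G.Adj b x
    · exact ⟨0, h, h1⟩
    by_cases h2 : G.Adj c x
    · exact ⟨1, h, h1, h2⟩
    · exact ⟨2, h, h1, h2⟩
  · intro i j x hi hj
    fin_cases i <;> fin_cases j <;> first | rfl | exfalso
    · exact hj.2.1 hi.2
    · exact hj.2.1 hi.2
    · exact hi.2.1 hj.2
    · exact hj.2.2 hi.2.2
    · exact hi.2.1 hj.2
    · exact hi.2.2 hj.2.2

/-- Second colouring scheme: two colours for each of `A_s ∪ B_r`, `A_t ∪ B_s`, `A_r ∪ B_t`. -/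
theorem schemeII (F : FO G) (T : TT G r s t)
    (hM : ∀ x y, MM G r s t x → MM G r s t y → ¬ G.Adj x y)
    (hm : ∀ m, MM G r s t m → ∀ x1 y1 x2 y2 x3 y3, x1 ≠ y1 → x2 ≠ y2 → x3 ≠ y3 →
      (AA G s t r x1 ∨ BB G r s t x1) → (AA G s t r y1 ∨ BB G r s t y1) →
      (AA G t r s x2 ∨ BB G s t r x2) → (AA G t r s y2 ∨ BB G s t r y2) →
      (AA G r s t x3 ∨ BB G t r s x3) → (AA G r s t y3 ∨ BB G t r s y3) →
      G.Adj m x1 → G.Adj m y1 → G.Adj m x2 → G.Adj m y2 → G.Adj m x3 → G.Adj m y3 → False) :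
    G.Colorable 6 := by
  obtain ⟨P1, Q1, d1, c1, p1, q1⟩ := pair F T
  obtain ⟨P2, Q2, d2, c2, p2, q2⟩ := pair F T.rot
  obtain ⟨P3, Q3, d3, c3, p3, q3⟩ := pair F T.rot.rot
  refine cover G ![fun v => P1 v ∨ v = r, Q1, fun v => P2 v ∨ v = s, Q2, fun v => P3 v ∨ v = t, Q3]
    (MM G r s t) ?_ hM ?_ ?_
  · intro i
    fin_cases i
    · refine stable_add p1 (fun x hx => ?_)
      rcases (c1 x).1 (Or.inl hx) with h | h
      · exact h.2.2
      · exact h.2.1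
    · exact q1
    · refine stable_add p2 (fun x hx => ?_)
      rcases (c2 x).1 (Or.inl hx) with h | h
      · exact h.2.2
      · exact h.2.1
    · exact q2
    · refine stable_add p3 (fun x hx => ?_)
      rcases (c3 x).1 (Or.inl hx) with h | h
      · exact h.2.2
      · exact h.2.1
    · exact q3
  · intro v
    by_cases hv : MM G r s t v
    · exact Or.inl hv
    right
    have k1 : AA G s t r v ∨ BB G r s t v → ∃ i, (![fun v => P1 v ∨ v = r, Q1,
        fun v => P2 v ∨ v = s, Q2, fun v => P3 v ∨ v = t, Q3] : Fin 6 → V → Prop) i v := by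
      intro h
      rcases (c1 v).2 h with h | h
      · exact ⟨0, Or.inl h⟩
      · exact ⟨1, h⟩
    have k2 : AA G t r s v ∨ BB G s t r v → ∃ i, (![fun v => P1 v ∨ v = r, Q1,
        fun v => P2 v ∨ v = s, Q2, fun v => P3 v ∨ v = t, Q3] : Fin 6 → V → Prop) i v := by
      intro h
      rcases (c2 v).2 h with h | h
      · exact ⟨2, Or.inl h⟩
      · exact ⟨3, h⟩
    have k3 : AA G r s t v ∨ BB G t r s v → ∃ i, (![fun v => P1 v ∨ v = r, Q1,
        fun v => P2 v ∨ v = s, Q2, fun v => P3 v ∨ v = t, Q3] : Fin 6 → V → Prop) i v := by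
      intro h
      rcases (c3 v).2 h with h | h
      · exact ⟨4, Or.inl h⟩
      · exact ⟨5, h⟩
    rcases classify F T v with h | h | h | h | h | h | h | h | h | h
    · exact absurd h hv
    · exact k3 (Or.inl h)
    · exact k1 (Or.inl h)
    · exact k2 (Or.inl h)
    · exact k1 (Or.inr h)
    · exact k2 (Or.inr h)
    · exact k3 (Or.inr h)
    · exact ⟨0, Or.inr h⟩
    · exact ⟨2, Or.inr h⟩
    · exact ⟨4, Or.inr h⟩
  · intro m hmm
    by_contra hcon
    push Not at hcon
    obtain ⟨x1, h1, m1⟩ := hcon 0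
    obtain ⟨y1, h1', m1'⟩ := hcon 1
    obtain ⟨x2, h2, m2⟩ := hcon 2
    obtain ⟨y2, h2', m2'⟩ := hcon 3
    obtain ⟨x3, h3, m3⟩ := hcon 4
    obtain ⟨y3, h3', m3'⟩ := hcon 5
    replace h1 : P1 x1 := h1.resolve_right (by rintro rfl; exact hmm.1 m1.symm)
    replace h2 : P2 x2 := h2.resolve_right (by rintro rfl; exact hmm.2.1 m2.symm)
    replace h3 : P3 x3 := h3.resolve_right (by rintro rfl; exact hmm.2.2 m3.symm)
    change Q1 y1 at h1'
    change Q2 y2 at h2'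
    change Q3 y3 at h3'
    exact hm m hmm x1 y1 x2 y2 x3 y3 (by rintro rfl; exact d1 _ h1 h1')
      (by rintro rfl; exact d2 _ h2 h2') (by rintro rfl; exact d3 _ h3 h3')
      ((c1 _).1 (Or.inl h1)) ((c1 _).1 (Or.inr h1')) ((c2 _).1 (Or.inl h2)) ((c2 _).1 (Or.inr h2'))
      ((c3 _).1 (Or.inl h3)) ((c3 _).1 (Or.inr h3')) m1 m1' m2 m2' m3 m3'

/-- If `m ∈ M` is complete to an edge of `A_r`, it does not have two neighbours
in `A_t ∪ B_s`. -/
theorem edge_contra (F : FO G) (T : TT G r s t) {m p q x y : V} (hm : MM G r s t m)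
    (hp : AA G r s t p) (hq : AA G r s t q) (hpq : G.Adj p q) (mp : G.Adj m p) (mq : G.Adj m q)
    (hx : AA G t r s x ∨ BB G s t r x) (hy : AA G t r s y ∨ BB G s t r y) (hne : x ≠ y)
    (mx : G.Adj m x) (my : G.Adj m y) : False := by
  have hx' := hx.resolve_right (fun h => edge_B F T hm hp hq hpq mp mq h mx)
  have hy' := hy.resolve_right (fun h => edge_B F T hm hp hq hpq mp mq h my)
  exact two_edges F T.rot.rot hx' hy' hp hq
    (M_nbrs F T.rot.rot hm.rot.rot hx' hy' mx my hne) hpq mx my mp mq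

theorem caseTriangle (F : FO G) (T : TT G r s t) : G.Colorable 6 := by
  by_cases hM : ∃ x y, MM G r s t x ∧ MM G r s t y ∧ G.Adj x y
  · obtain ⟨x, y, hx, hy, hxy⟩ := hM
    exact caseM F T hx hy hxy
  replace hM : ∀ x y, MM G r s t x → MM G r s t y → ¬ G.Adj x y :=
    fun x y hx hy h => hM ⟨x, y, hx, hy, h⟩
  by_cases hr : ∃ x y, AA G r s t x ∧ AA G r s t y ∧ G.Adj x y
  swap
  · exact caseStable F T.rot (fun x y hx hy => hM x y hx.rot.rot hy.rot.rot)
      (fun x y hx hy h => hr ⟨x, y, hx, hy, h⟩)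
  by_cases hs : ∃ x y, AA G s t r x ∧ AA G s t r y ∧ G.Adj x y
  swap
  · exact caseStable F T.rot.rot (fun x y hx hy => hM x y hx.rot hy.rot)
      (fun x y hx hy h => hs ⟨x, y, hx, hy, h⟩)
  by_cases ht : ∃ x y, AA G t r s x ∧ AA G t r s y ∧ G.Adj x y
  swap
  · exact caseStable F T hM (fun x y hx hy h => ht ⟨x, y, hx, hy, h⟩)
  obtain ⟨p, q, hp, hq, hpq⟩ := hr
  obtain ⟨u, v, hu, hv, huv⟩ := hs
  obtain ⟨z, w, hz, hw, hzw⟩ := ht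
  by_cases hbad : ∃ m b c, BB G r s t b ∧ BB G r s t c ∧ b ≠ c ∧ G.Adj m b ∧ G.Adj m c ∧
      ∀ x, AA G s t r x ∨ AA G t r s x → ¬ G.Adj m x
  · obtain ⟨m, b, c, hb, hc, hbc, mb, mc, hm⟩ := hbad
    exact caseBad F T hM hb hc hbc mb mc hm
  refine schemeII F T hM ?_
  intro m hm x1 y1 x2 y2 x3 y3 n1 n2 n3 hx1 hy1 hx2 hy2 hx3 hy3 mx1 my1 mx2 my2 mx3 my3
  by_cases mp : G.Adj m p
  · exact edge_contra F T hm hp hq hpq mp (M_edge F T hm hp hq hpq mp) hx2 hy2 n2 mx2 my2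
  by_cases mu : G.Adj m u
  · exact edge_contra F T.rot hm.rot hu hv huv mu (M_edge F T.rot hm.rot hu hv huv mu)
      hx3 hy3 n3 mx3 my3
  by_cases mz : G.Adj m z
  · exact edge_contra F T.rot.rot hm.rot.rot hz hw hzw mz
      (M_edge F T.rot.rot hm.rot.rot hz hw hzw mz) hx1 hy1 n1 mx1 my1
  have mq : ¬ G.Adj m q := fun h => mp (M_edge F T hm hq hp hpq.symm h)
  have mv : ¬ G.Adj m v := fun h => mu (M_edge F T.rot hm.rot hv hu huv.symm h)
  have mw : ¬ G.Adj m w := fun h => mz (M_edge F T.rot.rot hm.rot.rot hw hz hzw.symm h)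
  have hA : ∀ x, AA G s t r x ∨ AA G t r s x → ¬ G.Adj m x := by
    rintro x (hx | hx)
    · exact M_iso F T hm hx hp hq hz hw hpq hzw mp mq mz mw
    · exact M_iso F T.rot hm.rot hx hu hv hp hq huv hpq mu mv mp mq
  exact hbad ⟨m, x1, y1, hx1.resolve_left (fun h => hA _ (Or.inl h) mx1),
    hy1.resolve_left (fun h => hA _ (Or.inl h) my1), n1, mx1, my1, hA⟩

theorem caseNoTriangle (F : FO G) (hT : ∀ r s t, ¬ TT G r s t) : G.Colorable 6 := by
  by_cases hE : ∃ u v, G.Adj u v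
  swap
  · push Not at hE
    exact cover G (fun _ _ => True) (fun _ => False) (fun _ x y _ _ => hE x y) (by simp) (by simp)
      (by simp)
  obtain ⟨u, v, huv⟩ := hE
  have hc := G.adj_comm
  obtain ⟨D, hD1, hD2, hD3⟩ := split3 G (fun x => ¬ G.Adj u x ∧ ¬ G.Adj v x)
    (fun x y z hx hy hz hxy hyz hne => by
      by_contra h
      exact F.p x y z u v hxy hyz hne h huv (by grind) (by grind) (by grind) (by grind)
        (by grind) (by grind)) F.k
  refine cover G ![D 0, D 1, D 2, G.Adj u, G.Adj v, fun _ => False] (fun _ => False) ?_ (by simp) ?_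
    (by simp)
  · intro i x y hx hy h
    fin_cases i
    · exact hD3 0 x y hx hy h
    · exact hD3 1 x y hx hy h
    · exact hD3 2 x y hx hy h
    · exact hT u x y ⟨hx, h, hy.symm⟩
    · exact hT v x y ⟨hx, h, hy.symm⟩
    · exact hx
  · intro x
    right
    by_cases h1 : G.Adj u x
    · exact ⟨3, h1⟩
    by_cases h2 : G.Adj v x
    · exact ⟨4, h2⟩
    obtain ⟨i, hi⟩ := hD2 x ⟨h1, h2⟩
    fin_cases i
    · exact ⟨0, hi⟩
    · exact ⟨1, hi⟩
    · exact ⟨2, hi⟩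

end

theorem stmt10 {V : Type*} [Fintype V] (G : SimpleGraph V)
    (hP : IsEmpty (P3P2 ↪g G)) (hW : IsEmpty (W4 ↪g G)) (hK4 : G.CliqueFree 4) :
    G.chromaticNumber ≤ 6 := by
  have F := FO.of G hP hW hK4
  have h : G.Colorable 6 := by
    by_cases hT : ∃ r s t, TT G r s t
    · obtain ⟨r, s, t, T⟩ := hT
      exact caseTriangle F T
    · push Not at hT
      exact caseNoTriangle F hT
  exact h.chromaticNumber_le
end

section
/- Let G be a finite simple graph that is both (P3∪P2)-free and W4-free, with ω(G) = 3. Then χ(G) ≤ 6. -/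
open SimpleGraph

section helpers

variable {V : Type*} {G : SimpleGraph V}

/-- `G` restricted to `S` has a proper colouring with `n` colours. -/
def ColOn (G : SimpleGraph V) (S : Set V) (n : ℕ) : Prop :=
  ∃ c : V → ℕ, (∀ x ∈ S, c x < n) ∧ ∀ x ∈ S, ∀ y ∈ S, G.Adj x y → c x ≠ c y

lemma ColOn.union {S T : Set V} {m n : ℕ} (hS : ColOn G S m) (hT : ColOn G T n) :
    ColOn G (S ∪ T) (m + n) := by
  classical
  obtain ⟨c, hc, hc'⟩ := hS
  obtain ⟨d, hd, hd'⟩ := hT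
  refine ⟨fun x => if x ∈ S then c x else m + d x, ?_, ?_⟩
  · intro x hx
    by_cases h : x ∈ S
    · have := hc x h
      simp only [h, if_true]; omega
    · have := hd x (hx.resolve_left h)
      simp only [h, if_false]; omega
  · intro x hx y hy hxy
    by_cases h : x ∈ S <;> by_cases h' : y ∈ S <;> simp only [h, h', if_true, if_false]
    · exact hc' x h y h' hxy
    · have := hc x h
      omega
    · have := hc y h'
      omega
    · have := hd' x (hx.resolve_left h) y (hy.resolve_left h') hxy
      omega

lemma ColOn.of_indep {S : Set V} (h : ∀ x ∈ S, ∀ y ∈ S, ¬ G.Adj x y) : ColOn G S 1 :=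
  ⟨fun _ => 0, fun _ _ => Nat.one_pos, fun x hx y hy hxy => absurd hxy (h x hx y hy)⟩

lemma ColOn.mono {S T : Set V} {n : ℕ} (h : ColOn G T n) (hST : S ⊆ T) : ColOn G S n := by
  obtain ⟨c, hc, hc'⟩ := h
  exact ⟨c, fun x hx => hc x (hST hx), fun x hx y hy => hc' x (hST hx) y (hST hy)⟩

lemma ColOn.chromatic {n : ℕ} {S : Set V} (h : ColOn G S n) (hS : ∀ x, x ∈ S) :
    G.chromaticNumber ≤ n := by
  obtain ⟨c, hc, hc'⟩ := h
  have : G.Colorable n :=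
    ⟨Coloring.mk (fun x => (⟨c x, hc x (hS x)⟩ : Fin n)) (by
      intro x y hxy he
      exact hc' x (hS x) y (hS y) hxy (by simpa using congrArg Fin.val he))⟩
  exact this.chromaticNumber_le

/-- A set without induced `P3` and without `(n+1)`-clique is `n`-colourable. -/
lemma ColOn.of_P3free [Fintype V] {S : Set V} {n : ℕ}
    (hP : ∀ x ∈ S, ∀ y ∈ S, ∀ z ∈ S, G.Adj x y → G.Adj y z → x ≠ z → G.Adj x z)
    (hK : ∀ s : Finset V, (∀ x ∈ s, x ∈ S) → G.IsClique s → s.card ≤ n) : ColOn G S n := by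
  classical
  let r : Setoid S :=
    { r := fun x y => x = y ∨ G.Adj x y
      iseqv :=
        { refl := fun x => Or.inl rfl
          symm := by
            rintro x y (h | h)
            · exact Or.inl h.symm
            · exact Or.inr h.symm
          trans := by
            rintro x y z (h | h) (h' | h')
            · exact Or.inl (h.trans h')
            · subst h; exact Or.inr h'
            · subst h'; exact Or.inr h
            · by_cases e : x = z
              · exact Or.inl e
              · exact Or.inr (hP x x.2 y y.2 z z.2 h h' (fun h => e (Subtype.ext h))) } }
  have key : ∀ q : Quotient r, ∃ f : V → ℕ, (∀ x : S, ⟦x⟧ = q → f x < n) ∧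
      ∀ x y : S, ⟦x⟧ = q → ⟦y⟧ = q → f x = f y → x = y := by
    intro q
    let s : Finset V := Finset.univ.filter (fun v => ∃ h : v ∈ S, (⟦⟨v, h⟩⟧ : Quotient r) = q)
    have hs : s.card ≤ n := by
      apply hK
      · intro x hx
        obtain ⟨h, _⟩ := (Finset.mem_filter.1 hx).2
        exact h
      · intro x hx y hy hxy
        obtain ⟨h, e⟩ := (Finset.mem_filter.1 hx).2
        obtain ⟨h', e'⟩ := (Finset.mem_filter.1 hy).2
        have := Quotient.exact (e.trans e'.symm)
        rcases this with h1 | h1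
        · exact absurd (congrArg Subtype.val h1) hxy
        · exact h1
    let e := s.equivFin
    refine ⟨fun v => if h : v ∈ s then (e ⟨v, h⟩ : ℕ) else 0, ?_, ?_⟩
    · intro x hx
      have hm : (x : V) ∈ s := Finset.mem_filter.2 ⟨Finset.mem_univ _, x.2, hx⟩
      simp only [hm, dif_pos]
      exact lt_of_lt_of_le (e ⟨x, hm⟩).2 hs
    · intro x y hx hy hxy
      have hm : (x : V) ∈ s := Finset.mem_filter.2 ⟨Finset.mem_univ _, x.2, hx⟩
      have hm' : (y : V) ∈ s := Finset.mem_filter.2 ⟨Finset.mem_univ _, y.2, hy⟩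
      simp only [hm, hm', dif_pos] at hxy
      have := e.injective (Fin.ext hxy)
      exact Subtype.ext (Subtype.mk.inj this)
  choose f hf hf' using key
  refine ⟨fun v => if h : v ∈ S then f ⟦⟨v, h⟩⟧ v else 0, ?_, ?_⟩
  · intro x hx
    simp only [hx, dif_pos]
    exact hf _ ⟨x, hx⟩ rfl
  · intro x hx y hy hxy he
    simp only [hx, hy, dif_pos] at he
    have hq : (⟦⟨x, hx⟩⟧ : Quotient r) = ⟦⟨y, hy⟩⟧ := Quotient.sound (Or.inr hxy)
    rw [hq] at he
    have := hf' _ ⟨x, hx⟩ ⟨y, hy⟩ hq rfl he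
    exact hxy.ne (congrArg Subtype.val this)

/-- Elementary form of `(P3 ∪ P2)`-freeness. -/
def NoP (G : SimpleGraph V) : Prop := ∀ a b c d e : V, G.Adj a b → G.Adj b c → a ≠ c →
  ¬ G.Adj a c → G.Adj d e → ¬ G.Adj a d → ¬ G.Adj a e → ¬ G.Adj b d → ¬ G.Adj b e →
  ¬ G.Adj c d → ¬ G.Adj c e → False

/-- Elementary form of `W4`-freeness. -/
def NoW (G : SimpleGraph V) : Prop := ∀ a b c d h : V, G.Adj a b → G.Adj b c → G.Adj c d →
  G.Adj d a → a ≠ c → b ≠ d → ¬ G.Adj a c → ¬ G.Adj b d →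
  G.Adj h a → G.Adj h b → G.Adj h c → G.Adj h d → False

/-- Elementary form of `K4`-freeness. -/
def NoK (G : SimpleGraph V) : Prop := ∀ a b c d : V, G.Adj a b → G.Adj a c → G.Adj a d →
  G.Adj b c → G.Adj b d → G.Adj c d → False

lemma noP_of (hP : IsEmpty (P3P2 ↪g G)) : NoP G := by
  intro a b c d e ab bc nac ac de ad ae bd be cd ce
  have had : a ≠ d := by rintro rfl; exact bd ab.symm
  have hae : a ≠ e := by rintro rfl; exact be ab.symm
  have hbd : b ≠ d := by rintro rfl; exact ad ab
  have hbe : b ≠ e := by rintro rfl; exact ae ab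
  have hcd : c ≠ d := by rintro rfl; exact bd bc
  have hce : c ≠ e := by rintro rfl; exact be bc
  have hab := ab.ne
  have hbc := bc.ne
  have hde := de.ne
  refine hP.false ⟨⟨![a, b, c, d, e], ?_⟩, ?_⟩
  · intro i j h
    fin_cases i <;> fin_cases j <;> simp_all
  · intro i j
    change G.Adj (![a, b, c, d, e] i) (![a, b, c, d, e] j) ↔ _
    fin_cases i <;> fin_cases j <;> simp_all [P3P2, G.adj_comm]

lemma noW_of (hW : IsEmpty (W4 ↪g G)) : NoW G := by
  intro a b c d h ab bc cd da nac nbd ac bd ha hb hc hd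
  have h1 := ab.ne
  have h2 := bc.ne
  have h3 := cd.ne
  have h4 := da.ne
  have h5 := ha.ne
  have h6 := hb.ne
  have h7 := hc.ne
  have h8 := hd.ne
  refine hW.false ⟨⟨![a, b, c, d, h], ?_⟩, ?_⟩
  · intro i j h
    fin_cases i <;> fin_cases j <;> simp_all
  · intro i j
    change G.Adj (![a, b, c, d, h] i) (![a, b, c, d, h] j) ↔ _
    fin_cases i <;> fin_cases j <;> simp_all [W4, G.adj_comm]

lemma noK_of [Fintype V] (hω : G.cliqueNum = 3) : NoK G := by
  classical
  intro a b c d ab ac ad bc bd cd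
  have h : G.IsNClique 4 {a, b, c, d} := by
    have h3 : G.IsNClique 3 {b, c, d} := is3Clique_iff.2 ⟨b, c, d, bc, bd, cd, rfl⟩
    refine h3.insert ?_
    intro x hx
    simp only [Finset.mem_insert, Finset.mem_singleton] at hx
    rcases hx with rfl | rfl | rfl <;> assumption
  have := h.isClique.card_le_cliqueNum
  rw [h.card_eq, hω] at this
  omega

/-- The vertices `u`, `v` and the common non-neighbours of `u` and `v`. -/
def RS (G : SimpleGraph V) (u v : V) : Set V :=
  {x | x = u ∨ x = v ∨ (¬ G.Adj u x ∧ ¬ G.Adj v x)}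

lemma RS_P3free (hP : NoP G) {u v : V} (uv : G.Adj u v) : ∀ x ∈ RS G u v, ∀ y ∈ RS G u v,
    ∀ z ∈ RS G u v, G.Adj x y → G.Adj y z → x ≠ z → G.Adj x z := by
  intro x hx y hy z hz xy yz xz
  by_contra h
  have := hP x y z u v xy yz xz h uv
  simp only [RS, Set.mem_ofPred_eq] at hx hy hz
  have s := fun a b => G.adj_comm a b
  grind

lemma RS_col3 [Fintype V] (hP : NoP G) (hK : NoK G) {u v : V} (uv : G.Adj u v) :
    ColOn G (RS G u v) 3 := by
  classical
  refine ColOn.of_P3free (RS_P3free hP uv) ?_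
  intro s _ hs
  by_contra! hc
  obtain ⟨t, ht, hcard⟩ := Finset.exists_subset_card_eq (show 4 ≤ s.card by omega)
  obtain ⟨a, r, har, rfl, hr⟩ := Finset.card_eq_succ.1 hcard
  have h3 : G.IsNClique 3 r :=
    ⟨hs.subset (by simpa using (Finset.subset_insert a r).trans ht), hr⟩
  obtain ⟨b, c, d, bc, bd, cd, rfl⟩ := is3Clique_iff.1 h3
  have key : ∀ x ∈ ({b, c, d} : Finset V), G.Adj a x := fun x hx =>
    hs (ht (Finset.mem_insert_self _ _)) (ht (Finset.mem_insert_of_mem hx))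
      (fun h => har (h ▸ hx))
  exact hK a b c d (key b (by simp)) (key c (by simp)) (key d (by simp)) bc bd cd

/-- No induced `K3 ∪ K2`. -/
def NoKK (G : SimpleGraph V) : Prop := ∀ u v a b c : V, G.Adj u v → G.Adj a b → G.Adj a c →
  G.Adj b c → ¬ G.Adj u a → ¬ G.Adj u b → ¬ G.Adj u c → ¬ G.Adj v a → ¬ G.Adj v b →
  ¬ G.Adj v c → False

lemma RS_col2 [Fintype V] (hP : NoP G) (hKK : NoKK G) {u v : V} (uv : G.Adj u v) :
    ColOn G (RS G u v) 2 := by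
  classical
  refine ColOn.of_P3free (RS_P3free hP uv) ?_
  intro s hsS hs
  by_contra! hc
  obtain ⟨t, ht, hcard⟩ := Finset.exists_subset_card_eq (show 3 ≤ s.card by omega)
  have : G.IsNClique 3 t := ⟨hs.subset (by simpa using ht), hcard⟩
  obtain ⟨a, b, c, ab, ac, bc, rfl⟩ := is3Clique_iff.1 this
  have ha := hsS a (ht (by simp))
  have hb := hsS b (ht (by simp))
  have hc := hsS c (ht (by simp))
  simp only [RS, Set.mem_ofPred_eq] at ha hb hc
  have := hKK u v a b c uv ab ac bc
  have s := fun a b => G.adj_comm a b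
  have := ab.ne
  have := ac.ne
  have := bc.ne
  grind

/-- Vertices with exactly two neighbours in the triangle `a b c` (outside the triangle). -/
def DS (G : SimpleGraph V) (a b c : V) : Set V :=
  {x | x ≠ a ∧ x ≠ b ∧ x ≠ c ∧ ((G.Adj a x ∧ G.Adj b x ∧ ¬ G.Adj c x) ∨
    (G.Adj a x ∧ ¬ G.Adj b x ∧ G.Adj c x) ∨ (¬ G.Adj a x ∧ G.Adj b x ∧ G.Adj c x))}

lemma DS_indep (hW : NoW G) (hK : NoK G) {a b c : V} (ab : G.Adj a b) (ac : G.Adj a c)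
    (bc : G.Adj b c) : ∀ x ∈ DS G a b c, ∀ y ∈ DS G a b c, ¬ G.Adj x y := by
  -- two vertices attached to different edges of a triangle
  have W : ∀ p q r x y, G.Adj p q → G.Adj p r → G.Adj q r → G.Adj p x → G.Adj q x →
      ¬ G.Adj r x → G.Adj p y → G.Adj r y → ¬ G.Adj q y → x ≠ r → y ≠ q → ¬ G.Adj x y := by
    intro p q r x y pq pr qr px qx rx py ry qy nx ny xy
    exact hW x q r y p qx.symm qr ry xy.symm nx (Ne.symm ny) (fun h => rx h.symm) qy px pq pr py
  rintro x ⟨xa, xb, xc, hx⟩ y ⟨ya, yb, yc, hy⟩ xy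
  rcases hx with ⟨h1, h2, h3⟩ | ⟨h1, h2, h3⟩ | ⟨h1, h2, h3⟩ <;>
    rcases hy with ⟨k1, k2, k3⟩ | ⟨k1, k2, k3⟩ | ⟨k1, k2, k3⟩
  · exact hK a b x y ab h1 k1 h2 k2 xy
  · exact W a b c x y ab ac bc h1 h2 h3 k1 k3 k2 xc yb xy
  · exact W b a c x y ab.symm bc ac h2 h1 h3 k2 k3 k1 xc ya xy
  · exact W a b c y x ab ac bc k1 k2 k3 h1 h3 h2 yc xb xy.symm
  · exact hK a c x y ac h1 k1 h3 k3 xy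
  · exact W c a b x y ac.symm bc.symm ab h3 h1 h2 k3 k2 k1 xb ya xy
  · exact W b a c y x ab.symm bc ac k2 k1 k3 h2 h3 h1 yc xa xy.symm
  · exact W c a b y x ac.symm bc.symm ab k3 k1 k2 h3 h2 h1 yb xa xy.symm
  · exact hK b c x y bc h2 k2 h3 k3 xy

/-- If there is an induced `K3 ∪ K2` then five colours suffice. -/
lemma case_KK [Fintype V] (hP : NoP G) (hW : NoW G) (hK : NoK G) {u v a b c : V}
    (uv : G.Adj u v) (ab : G.Adj a b) (ac : G.Adj a c) (bc : G.Adj b c) (ua : ¬ G.Adj u a)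
    (ub : ¬ G.Adj u b) (uc : ¬ G.Adj u c) (va : ¬ G.Adj v a) (vb : ¬ G.Adj v b)
    (vc : ¬ G.Adj v c) : G.chromaticNumber ≤ 6 := by
  have h1 : ColOn G {x | G.Adj u x ∧ G.Adj v x} 1 :=
    ColOn.of_indep fun x hx y hy xy => hK u v x y uv hx.1 hy.1 hx.2 hy.2 xy
  have h2 : ColOn G (DS G a b c) 1 := ColOn.of_indep (DS_indep hW hK ab ac bc)
  have h3 := RS_col3 hP hK uv
  have key : ∀ u v x, G.Adj u v → ¬ G.Adj u a → ¬ G.Adj u b → ¬ G.Adj u c → ¬ G.Adj v a →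
      ¬ G.Adj v b → ¬ G.Adj v c → G.Adj u x → ¬ G.Adj v x → x ≠ v → x ∈ DS G a b c := by
    intro u v x uv ua ub uc va vb vc ux vx xv
    have p1 := hP x u v a b ux.symm uv xv (fun h => vx h.symm) ab
    have p2 := hP x u v a c ux.symm uv xv (fun h => vx h.symm) ac
    have p3 := hP x u v b c ux.symm uv xv (fun h => vx h.symm) bc
    have p4 := hK a b c x ab ac
    have s := fun a b => G.adj_comm a b
    simp only [DS, Set.mem_ofPred_eq]
    grind
  have h := (h1.union h2).union h3
  refine (h.chromatic ?_).trans (by norm_num)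
  intro x
  by_cases xu : x = u
  · exact Or.inr (Or.inl xu)
  by_cases xv : x = v
  · exact Or.inr (Or.inr (Or.inl xv))
  by_cases hu : G.Adj u x <;> by_cases hv : G.Adj v x
  · exact Or.inl (Or.inl ⟨hu, hv⟩)
  · exact Or.inl (Or.inr (key u v x uv ua ub uc va vb vc hu hv xv))
  · exact Or.inl (Or.inr (key v u x uv.symm va vb vc ua ub uc hv hu xu))
  · exact Or.inr (Or.inr (Or.inr ⟨hu, hv⟩))

/-- A diamond, and no induced `K3 ∪ K2`. -/
lemma case_diamond [Fintype V] (hP : NoP G) (hW : NoW G) (hK : NoK G) (hKK : NoKK G)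
    {a b c w : V} (ab : G.Adj a b) (ac : G.Adj a c) (bc : G.Adj b c) (bw : G.Adj b w)
    (cw : G.Adj c w) (wa : w ≠ a) : G.chromaticNumber ≤ 6 := by
  have aw : ¬ G.Adj a w := fun h => hK a b c w ab ac h bc bw cw
  have h1 : ColOn G (DS G a b c) 1 := ColOn.of_indep (DS_indep hW hK ab ac bc)
  have h2 : ColOn G {x | G.Adj w x ∧ ((G.Adj b x ∧ ¬ G.Adj c x ∧ x ≠ c) ∨
      (¬ G.Adj b x ∧ G.Adj c x ∧ x ≠ b))} 1 := by
    apply ColOn.of_indep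
    have W : ∀ x y, G.Adj w x → G.Adj w y → G.Adj b x → ¬ G.Adj c x → x ≠ c → ¬ G.Adj b y →
        G.Adj c y → y ≠ b → ¬ G.Adj x y := by
      intro x y wx wy bx cx xc b_y cy yb xy
      exact hW b c y x w bc cy xy.symm bx.symm (Ne.symm yb) (Ne.symm xc) b_y cx bw.symm cw.symm
        wy wx
    rintro x ⟨wx, ⟨p1, p2, p3⟩ | ⟨p1, p2, p3⟩⟩ y ⟨wy, ⟨q1, q2, q3⟩ | ⟨q1, q2, q3⟩⟩ xy
    · exact hK b w x y bw p1 q1 wx wy xy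
    · exact W x y wx wy p1 p2 p3 q1 q2 q3 xy
    · exact W y x wy wx q1 q2 q3 p1 p2 p3 xy.symm
    · exact hK c w x y cw p2 q2 wx wy xy
  have h34 : ∀ b c, G.Adj a b → G.Adj a c → G.Adj b c → G.Adj b w → G.Adj c w →
      ColOn G {x | x = a ∨ (¬ G.Adj w x ∧ G.Adj b x ∧ ¬ G.Adj c x ∧ ¬ G.Adj a x)} 1 := by
    intro b c ab ac bc bw cw
    apply ColOn.of_indep
    rintro x (rfl | ⟨p1, p2, p3, p4⟩) y (rfl | ⟨q1, q2, q3, q4⟩) xy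
    · exact G.irrefl xy
    · exact q4 xy
    · exact p4 xy.symm
    · exact hP a c w x y ac cw wa.symm aw xy p4 q4 p3 q3 p1 q1
  have h3 := h34 b c ab ac bc bw cw
  have h4 : ColOn G {x | x = b ∨ (¬ G.Adj w x ∧ G.Adj c x ∧ ¬ G.Adj b x ∧ ¬ G.Adj a x)} 1 := by
    have h := h34 c b ac ab bc.symm cw bw
    obtain ⟨f, hf, hf'⟩ := h
    apply ColOn.of_indep
    rintro x (rfl | ⟨p1, p2, p3, p4⟩) y (rfl | ⟨q1, q2, q3, q4⟩) xy
    · exact G.irrefl xy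
    · exact q3 xy
    · exact p3 xy.symm
    · exact hP a b w x y ab bw wa.symm aw xy p4 q4 p3 q3 p1 q1
  have h5 := RS_col2 hP hKK bc
  have h := (((h1.union h2).union h3).union h4).union h5
  refine (h.chromatic ?_).trans (by norm_num)
  intro x
  have := hK a b c x ab ac
  simp only [DS, RS, Set.mem_union, Set.mem_ofPred_eq]
  grind

/-- No diamond on the triangle `a b c`, and no induced `K3 ∪ K2`. -/
lemma case_no_diamond [Fintype V] (hP : NoP G) (hKK : NoKK G)
    {a b c : V} (ab : G.Adj a b) (ac : G.Adj a c) (bc : G.Adj b c)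
    (nab : ∀ w, G.Adj a w → G.Adj b w → w = c) (nac : ∀ w, G.Adj a w → G.Adj c w → w = b)
    (nbc : ∀ w, G.Adj b w → G.Adj c w → w = a) : G.chromaticNumber ≤ 6 := by
  have h := ((RS_col2 hP hKK ab).union (RS_col2 hP hKK ac)).union (RS_col2 hP hKK bc)
  refine (h.chromatic ?_).trans (by norm_num)
  intro x
  have := nab x
  have := nac x
  have := nbc x
  simp only [RS, Set.mem_union, Set.mem_ofPred_eq]
  grind

end helpers

theorem stmt11 {V : Type*} [Fintype V] (G : SimpleGraph V)
    (hP : IsEmpty (P3P2 ↪g G)) (hW : IsEmpty (W4 ↪g G)) (hω : G.cliqueNum = 3) :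
    G.chromaticNumber ≤ 6 := by
  classical
  have hP' := noP_of hP
  have hW' := noW_of hW
  have hK := noK_of hω
  by_cases hKK : NoKK G
  · obtain ⟨s, hs⟩ := G.exists_isNClique_cliqueNum
    rw [hω] at hs
    obtain ⟨a, b, c, ab, ac, bc, -⟩ := is3Clique_iff.1 hs
    by_contra hcon
    refine hcon (case_no_diamond hP' hKK ab ac bc ?_ ?_ ?_)
    · intro w h1 h2
      by_contra hne
      exact hcon (case_diamond hP' hW' hK hKK ac.symm bc.symm ab h1 h2 hne)
    · intro w h1 h2
      by_contra hne
      exact hcon (case_diamond hP' hW' hK hKK ab.symm bc ac h1 h2 hne)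
    · intro w h1 h2
      by_contra hne
      exact hcon (case_diamond hP' hW' hK hKK ab ac bc h1 h2 hne)
  · unfold NoKK at hKK
    push Not at hKK
    obtain ⟨u, v, a, b, c, uv, ab, ac, bc, ua, ub, uc, va, vb, vc, -⟩ := hKK
    exact case_KK hP' hW' hK uv ab ac bc ua ub uc va vb vc
end

section
/- Let G be a finite simple graph that is (P3∪P2)-free, W4-free and K4-free. If G contains an induced subgraph isomorphic to P2∪K3 (the disjoint union of an edge and a triangle), then χ(G) ≤ 6. -/
open SimpleGraph

/-- Forbidden `P3 ∪ P2` in elementary form. -/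
theorem no_P3P2 {V : Type*} (G : SimpleGraph V) (hP : IsEmpty (P3P2 ↪g G)) (a b c d e : V)
    (hab : G.Adj a b) (hbc : G.Adj b c) (hac : ¬ G.Adj a c) (hne : a ≠ c) (hde : G.Adj d e)
    (had : ¬ G.Adj a d) (hae : ¬ G.Adj a e) (hbd : ¬ G.Adj b d) (hbe : ¬ G.Adj b e)
    (hcd : ¬ G.Adj c d) (hce : ¬ G.Adj c e) : False := by
  have h1 := hab.ne
  have h2 := hbc.ne
  have h3 := hde.ne
  have had' : a ≠ d := by rintro rfl; exact hbd hab.symm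
  have hae' : a ≠ e := by rintro rfl; exact hbe hab.symm
  have hbd' : b ≠ d := by rintro rfl; exact had hab
  have hbe' : b ≠ e := by rintro rfl; exact hae hab
  have hcd' : c ≠ d := by rintro rfl; exact hbd hbc
  have hce' : c ≠ e := by rintro rfl; exact hbe hbc
  refine hP.false ⟨⟨![a, b, c, d, e], ?_⟩, ?_⟩
  · intro i j hij
    fin_cases i <;> fin_cases j <;> simp_all
  · intro i j
    change G.Adj (![a, b, c, d, e] i) (![a, b, c, d, e] j) ↔ _
    have s1 := hab.symm
    have s2 := hbc.symm
    have s3 := hde.symm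
    have n1 := mt (G.adj_comm _ _).1 hac
    have n2 := mt (G.adj_comm _ _).1 had
    have n3 := mt (G.adj_comm _ _).1 hae
    have n4 := mt (G.adj_comm _ _).1 hbd
    have n5 := mt (G.adj_comm _ _).1 hbe
    have n6 := mt (G.adj_comm _ _).1 hcd
    have n7 := mt (G.adj_comm _ _).1 hce
    clear hP
    fin_cases i <;> fin_cases j <;> simp [P3P2] <;> assumption

/-- No `K4`, in elementary form. -/
theorem no_K4 {V : Type*} (G : SimpleGraph V) (h : G.CliqueFree 4) (a b c d : V)
    (hab : G.Adj a b) (hac : G.Adj a c) (had : G.Adj a d) (hbc : G.Adj b c) (hbd : G.Adj b d)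
    (hcd : G.Adj c d) : False := by
  classical
  exact h {a, b, c, d} ⟨by
    simp [isClique_iff, Set.Pairwise, hab, hac, had, hbc, hbd, hcd, hab.symm, hac.symm, had.symm,
      hbc.symm, hbd.symm, hcd.symm], by
    simp [hab.ne, hac.ne, had.ne, hbc.ne, hbd.ne, hcd.ne]⟩

/-- A set on which adjacency is transitive is coloured greedily. -/
theorem greedy {V : Type*} [Fintype V] (G : SimpleGraph V) (S : Set V) (k : ℕ)
    (htr : ∀ a ∈ S, ∀ b ∈ S, ∀ c ∈ S, G.Adj a b → G.Adj b c → a ≠ c → G.Adj a c)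
    (hk : ∀ t : Finset V, (∀ v ∈ t, v ∈ S) → G.IsClique (t : Set V) → t.card ≤ k) :
    ∃ f : V → ℕ, (∀ v ∈ S, f v < k) ∧ ∀ u ∈ S, ∀ v ∈ S, G.Adj u v → f u ≠ f v := by
  classical
  let o := Fintype.equivFin V
  let p : V → Finset V := fun v => Finset.univ.filter fun u => u ∈ S ∧ G.Adj u v ∧ o u < o v
  have hp : ∀ u v, u ∈ p v ↔ u ∈ S ∧ G.Adj u v ∧ o u < o v := by intro u v; simp [p]
  have key : ∀ u ∈ S, ∀ v ∈ S, G.Adj u v → o u < o v → (p u).card < (p v).card := by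
    intro u hu v hv huv hlt
    apply Finset.card_lt_card
    rw [Finset.ssubset_iff_of_subset]
    · exact ⟨u, (hp u v).2 ⟨hu, huv, hlt⟩, fun h => (G.loopless.irrefl u ((hp u u).1 h).2.1)⟩
    · intro x hx
      obtain ⟨hxS, hxu, hxlt⟩ := (hp x u).1 hx
      refine (hp x v).2 ⟨hxS, htr x hxS u hu v hv hxu huv ?_, hxlt.trans hlt⟩
      rintro rfl
      exact absurd (hxlt.trans hlt) (lt_irrefl _)
  refine ⟨fun v => (p v).card, ?_, ?_⟩
  · intro v hv
    have hnot : v ∉ p v := fun h => G.loopless.irrefl v ((hp v v).1 h).2.1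
    have := hk (insert v (p v)) ?_ ?_
    · rw [Finset.card_insert_of_notMem hnot] at this
      exact this
    · intro x hx
      rcases Finset.mem_insert.1 hx with rfl | hx
      · exact hv
      · exact ((hp x v).1 hx).1
    · intro x hx y hy hxy
      simp only [Finset.coe_insert, Set.mem_insert_iff, Finset.mem_coe] at hx hy
      rcases hx with rfl | hx <;> rcases hy with rfl | hy
      · exact absurd rfl hxy
      · exact ((hp y x).1 hy).2.1.symm
      · exact ((hp x y).1 hx).2.1
      · obtain ⟨hxS, hxv, -⟩ := (hp x v).1 hx
        obtain ⟨hyS, hyv, -⟩ := (hp y v).1 hy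
        exact htr x hxS v hv y hyS hxv hyv.symm hxy
  · intro u hu v hv huv
    rcases lt_trichotomy (o u) (o v) with h | h | h
    · exact (key u hu v hv huv h).ne
    · exact absurd (o.injective h) huv.ne
    · exact (key v hv u hu huv.symm h).ne'

theorem stmt12 {V : Type*} [Fintype V] (G : SimpleGraph V)
    (hP : IsEmpty (P3P2 ↪g G)) (hW : IsEmpty (W4 ↪g G)) (hK4 : G.CliqueFree 4)
    (hQ : Nonempty (P2K3 ↪g G)) :
    G.chromaticNumber ≤ 6 := by
  classical
  obtain ⟨φ⟩ := hQ
  have H := no_P3P2 G hP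
  have K := no_K4 G hK4
  obtain ⟨x, y, z, u, v, hxy, hxz, hyz, huv, hux, huy, huz, hvx, hvy, hvz⟩ :
      ∃ x y z u v : V, G.Adj x y ∧ G.Adj x z ∧ G.Adj y z ∧ G.Adj u v ∧ ¬ G.Adj u x ∧ ¬ G.Adj u y ∧
        ¬ G.Adj u z ∧ ¬ G.Adj v x ∧ ¬ G.Adj v y ∧ ¬ G.Adj v z := by
    refine ⟨φ 2, φ 3, φ 4, φ 0, φ 1, ?_, ?_, ?_, ?_, ?_, ?_, ?_, ?_, ?_, ?_⟩ <;>
      rw [φ.map_adj_iff] <;> simp [P2K3]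
  have C := fun a b => G.adj_comm a b
  let two : V → Prop := fun w =>
    (G.Adj w x ∧ G.Adj w y) ∨ (G.Adj w x ∧ G.Adj w z) ∨ (G.Adj w y ∧ G.Adj w z)
  -- a vertex with exactly one neighbour in a triangle is complete to the edge
  have main : ∀ a b c : V, G.Adj a b → G.Adj a c → G.Adj b c → ¬ G.Adj u a → ¬ G.Adj u b →
      ¬ G.Adj u c → ¬ G.Adj v a → ¬ G.Adj v b → ¬ G.Adj v c →
      ∀ w, G.Adj w a → ¬ G.Adj w b → ¬ G.Adj w c → G.Adj w u ∧ G.Adj w v := by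
    intro a b c hab hac hbc ua ub uc va vb vc w wa wb wc
    have hwb : w ≠ b := by rintro rfl; exact wc hbc
    have hwu : w ≠ u := by rintro rfl; exact ua wa
    have hwv : w ≠ v := by rintro rfl; exact va wa
    by_cases h1 : G.Adj w u
    · by_cases h2 : G.Adj w v
      · exact ⟨h1, h2⟩
      · exact (H w u v b c h1 huv h2 hwv hbc wb wc ub uc vb vc).elim
    · by_cases h2 : G.Adj w v
      · exact (H w v u b c h2 huv.symm h1 hwu hbc wb wc vb vc ub uc).elim
      · exact (H w a b u v wa hab wb hwb huv h1 h2 (fun h => ua h.symm) (fun h => va h.symm)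
          (fun h => ub h.symm) (fun h => vb h.symm)).elim
  have one : ∀ w, ¬ two w → (G.Adj w x ∨ G.Adj w y ∨ G.Adj w z) → G.Adj w u ∧ G.Adj w v := by
    intro w hw h
    simp only [two, not_or, not_and] at hw
    obtain ⟨h1, h2, h3⟩ := hw
    rcases h with h | h | h
    · exact main x y z hxy hxz hyz hux huy huz hvx hvy hvz w h (h1 h) (h2 h)
    · exact main y x z hxy.symm hyz hxz huy hux huz hvy hvx hvz w h (fun h' => h1 h' h) (h3 h)
    · exact main z x y hxz.symm hyz.symm hxy huz hux huy hvz hvx hvy w h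
        (fun h' => h2 h' h) (fun h' => h3 h' h)
  -- adjacency is transitive on non-neighbours of the triangle
  have trans' : ∀ S : Set V, (∀ w ∈ S, ¬ G.Adj w x ∧ ¬ G.Adj w y ∧ ¬ G.Adj w z) →
      ∀ a ∈ S, ∀ b ∈ S, ∀ c ∈ S, G.Adj a b → G.Adj b c → a ≠ c → G.Adj a c := by
    intro S hS a ha b hb c hc hab hbc hne
    by_contra hac
    exact H a b c x y hab hbc hac hne hxy (hS a ha).1 (hS a ha).2.1 (hS b hb).1 (hS b hb).2.1
      (hS c hc).1 (hS c hc).2.1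
  have I : ∀ a b p q : V, G.Adj a b → G.Adj p a → G.Adj p b → G.Adj q a → G.Adj q b →
      ¬ G.Adj p q := fun a b p q hab pa pb qa qb hpq => K p q a b hpq pa pb qa qb hab
  suffices hcol : ∃ c : V → ℕ, (∀ w, c w < 6) ∧ ∀ p q, G.Adj p q → c p ≠ c q by
    obtain ⟨c, hc6, hc⟩ := hcol
    have : G.Colorable 6 := ⟨Coloring.mk (fun w => (⟨c w, hc6 w⟩ : Fin 6)) (by
      intro p q hpq h
      exact hc p q hpq (by simpa using h))⟩
    exact_mod_cast this.chromaticNumber_le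
  by_cases hA : ∀ w, ¬ two w → ¬ G.Adj w x ∧ ¬ G.Adj w y ∧ ¬ G.Adj w z
  · obtain ⟨f, hf, hfc⟩ := greedy G {w | ¬ two w} 3 (trans' _ hA) (by
      intro t _ ht
      by_contra hlt
      exact (hK4.mono (show 4 ≤ t.card by omega)) t ⟨ht, rfl⟩)
    refine ⟨fun w => if G.Adj w x ∧ G.Adj w y then 0 else if G.Adj w x ∧ G.Adj w z then 1 else
      if G.Adj w y ∧ G.Adj w z then 2 else 3 + f w, ?_, ?_⟩
    · intro w
      have := hf w
      simp only [two, Set.mem_ofPred_eq, not_or] at this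
      dsimp only
      split_ifs with h1 h2 h3
      · omega
      · omega
      · omega
      · have := this ⟨h1, h2, h3⟩
        omega
    · intro p q hpq
      have h0 := hfc p
      have i1 := I x y p q hxy
      have i2 := I x z p q hxz
      have i3 := I y z p q hyz
      simp only [two, Set.mem_ofPred_eq, not_or] at h0
      dsimp only
      split_ifs with a1 b1 b2 b3 a2 b1 b2 b3 a3 b1 b2 b3 b1 b2 b3
      all_goals first
        | omega
        | exact absurd hpq (i1 a1.1 a1.2 b1.1 b1.2)
        | exact absurd hpq (i2 a2.1 a2.2 b2.1 b2.2)
        | exact absurd hpq (i3 a3.1 a3.2 b3.1 b3.2)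
        | (have := h0 ⟨a1, a2, a3⟩ q ⟨b1, b2, b3⟩ hpq
           omega)
  · -- no triangle among the vertices without neighbours in the triangle
    have tri : ∀ a b c, G.Adj a b → G.Adj a c → G.Adj b c →
        ∀ w, G.Adj w a → ¬ G.Adj w b → ¬ G.Adj w c → ∀ p q r, G.Adj p q → G.Adj p r → G.Adj q r →
        (∀ s, s = p ∨ s = q ∨ s = r → ¬ G.Adj s a ∧ ¬ G.Adj s b ∧ ¬ G.Adj s c) → False := by
      intro a b c hab hac hbc w wa wb wc p q r hpq hpr hqr hs
      have hwb : w ≠ b := by rintro rfl; exact wc hbc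
      have hp := hs p (by simp)
      have hq := hs q (by simp)
      have hr := hs r (by simp)
      have np : w ≠ p := by rintro rfl; exact hp.1 wa
      have nq : w ≠ q := by rintro rfl; exact hq.1 wa
      have nr : w ≠ r := by rintro rfl; exact hr.1 wa
      -- no edge of the second triangle avoids `w`
      have e1 : ∀ s t, G.Adj s t → (¬ G.Adj s a ∧ ¬ G.Adj s b ∧ ¬ G.Adj s c) →
          (¬ G.Adj t a ∧ ¬ G.Adj t b ∧ ¬ G.Adj t c) → ¬ G.Adj w s → ¬ G.Adj w t → False := by
        intro s t hst h1 h2 ws wt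
        exact H w a b s t wa hab wb hwb hst ws wt (fun h => h1.1 h.symm) (fun h => h2.1 h.symm)
          (fun h => h1.2.1 h.symm) (fun h => h2.2.1 h.symm)
      -- no edge of the second triangle is split by `w`
      have e2 : ∀ s t, G.Adj s t → (¬ G.Adj s a ∧ ¬ G.Adj s b ∧ ¬ G.Adj s c) →
          (¬ G.Adj t a ∧ ¬ G.Adj t b ∧ ¬ G.Adj t c) → w ≠ t → G.Adj w s → G.Adj w t := by
        intro s t hst h1 h2 nt ws
        by_contra wt
        exact H w s t b c ws hst wt nt hbc wb wc h1.2.1 h1.2.2 h2.2.1 h2.2.2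
      by_cases wp : G.Adj w p
      · exact K w p q r wp (e2 p q hpq hp hq nq wp) (e2 p r hpr hp hr nr wp) hpq hpr hqr
      · by_cases wq : G.Adj w q
        · exact wp (e2 q p hpq.symm hq hp np wq)
        · exact e1 p q hpq hp hq wp wq
    push Not at hA
    obtain ⟨w, hw2, hw⟩ := hA
    have noTri : ∀ p q r, G.Adj p q → G.Adj p r → G.Adj q r →
        (∀ s, s = p ∨ s = q ∨ s = r → ¬ G.Adj s x ∧ ¬ G.Adj s y ∧ ¬ G.Adj s z) → False := by
      intro p q r hpq hpr hqr hs
      simp only [two, not_or, not_and] at hw2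
      obtain ⟨h1, h2, h3⟩ := hw2
      by_cases wx : G.Adj w x
      · exact tri x y z hxy hxz hyz w wx (h1 wx) (h2 wx) p q r hpq hpr hqr hs
      · by_cases wy : G.Adj w y
        · exact tri y x z hxy.symm hyz hxz w wy wx (h3 wy) p q r hpq hpr hqr
            (fun s h => ⟨(hs s h).2.1, (hs s h).1, (hs s h).2.2⟩)
        · exact tri z x y hxz.symm hyz.symm hxy w (hw wx wy) wx wy p q r hpq hpr hqr
            (fun s h => ⟨(hs s h).2.2, (hs s h).1, (hs s h).2.1⟩)
    have hS : ∀ w ∈ {w | ¬ two w ∧ ¬ (G.Adj w u ∧ G.Adj w v)},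
        ¬ G.Adj w x ∧ ¬ G.Adj w y ∧ ¬ G.Adj w z := by
      rintro w ⟨h1, h2⟩
      have := mt (one w h1) h2
      tauto
    obtain ⟨f, hf, hfc⟩ := greedy G _ 2 (trans' _ hS) (by
      intro t htS ht
      by_contra hlt
      obtain ⟨p, hp, q, hq, r, hr, hpq, hpr, hqr⟩ := Finset.two_lt_card.1 (not_le.1 hlt)
      refine noTri p q r (ht hp hq hpq) (ht hp hr hpr) (ht hq hr hqr) ?_
      rintro s (rfl | rfl | rfl)
      · exact hS _ (htS _ hp)
      · exact hS _ (htS _ hq)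
      · exact hS _ (htS _ hr))
    refine ⟨fun w => if G.Adj w x ∧ G.Adj w y then 0 else if G.Adj w x ∧ G.Adj w z then 1 else
      if G.Adj w y ∧ G.Adj w z then 2 else if G.Adj w u ∧ G.Adj w v then 3 else 4 + f w, ?_, ?_⟩
    · intro w
      have := hf w
      simp only [two, Set.mem_ofPred_eq, not_or] at this
      dsimp only
      split_ifs with h1 h2 h3 h4
      · omega
      · omega
      · omega
      · omega
      · have := this ⟨⟨h1, h2, h3⟩, h4⟩
        omega
    · intro p q hpq
      have h0 := hfc p
      have i1 := I x y p q hxy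
      have i2 := I x z p q hxz
      have i3 := I y z p q hyz
      have i4 := I u v p q huv
      simp only [two, Set.mem_ofPred_eq, not_or] at h0
      dsimp only
      split_ifs with a1 b1 b2 b3 b4 a2 b1 b2 b3 b4 a3 b1 b2 b3 b4 a4 b1 b2 b3 b4 b1 b2 b3 b4
      all_goals first
        | omega
        | exact absurd hpq (i1 a1.1 a1.2 b1.1 b1.2)
        | exact absurd hpq (i2 a2.1 a2.2 b2.1 b2.2)
        | exact absurd hpq (i3 a3.1 a3.2 b3.1 b3.2)
        | exact absurd hpq (i4 a4.1 a4.2 b4.1 b4.2)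
        | (have := h0 ⟨⟨a1, a2, a3⟩, a4⟩ q ⟨⟨b1, b2, b3⟩, b4⟩ hpq
           omega)
end

section
/- Let G be a finite simple graph that is (P3∪P2)-free, W4-free, K4-free, (P2∪K3)-free and F1-free. If G contains an induced subgraph isomorphic to F2, then χ(G) ≤ 6. -/
open SimpleGraph

/-- `F1`: 6-cycle v1 v2 u2 u1 u3 v3 (= 0 1 2 3 4 5) plus edges v2v3 (1-5) and u2u3 (2-4). -/
def F1 : SimpleGraph (Fin 6) :=
  SimpleGraph.fromEdgeSet {s(0,1), s(1,2), s(2,3), s(3,4), s(4,5), s(5,0), s(1,5), s(2,4)}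

/-- `F2`: 5-cycle v1 v2 u3 u1 u2 (= 0 1 2 3 4) plus a vertex u4 (= 5) adjacent to u1, u2, u3. -/
def F2 : SimpleGraph (Fin 6) :=
  SimpleGraph.fromEdgeSet {s(0,1), s(1,2), s(2,3), s(3,4), s(4,0), s(5,2), s(5,3), s(5,4)}


/-- An injective map respecting adjacency and non-adjacency gives an induced copy. -/
lemma no_copy {V : Type*} {G : SimpleGraph V} {n : ℕ} {H : SimpleGraph (Fin n)}
    (h : IsEmpty (H ↪g G)) (f : Fin n → V)
    (hf : ∀ i j, i < j → f i ≠ f j ∧ (G.Adj (f i) (f j) ↔ H.Adj i j)) : False := by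
  refine h.false ⟨⟨f, ?_⟩, ?_⟩
  · intro i j hij
    rcases lt_trichotomy i j with h | h | h
    · exact absurd hij (hf i j h).1
    · exact h
    · exact absurd hij.symm (hf j i h).1
  · intro i j
    rcases lt_trichotomy i j with h | h | h
    · exact (hf i j h).2
    · subst h; simp
    · have := (hf j i h).2
      rw [G.adj_comm, H.adj_comm] at this
      exact this

section forbidden
variable {V : Type*} {G : SimpleGraph V}

lemma forb_P3P2 (h : IsEmpty (P3P2 ↪g G)) (a b c d e : V)
    (hab : G.Adj a b) (hbc : G.Adj b c) (hde : G.Adj d e) (hac : ¬ G.Adj a c)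
    (had : ¬ G.Adj a d) (hae : ¬ G.Adj a e) (hbd : ¬ G.Adj b d) (hbe : ¬ G.Adj b e)
    (hcd : ¬ G.Adj c d) (hce : ¬ G.Adj c e) (nac : a ≠ c) : False := by
  have := hab.ne; have := hbc.ne; have := hde.ne
  have : a ≠ d := by rintro rfl; exact hae hde
  have : a ≠ e := by rintro rfl; exact had hde.symm
  have : b ≠ d := by rintro rfl; exact had hab
  have : b ≠ e := by rintro rfl; exact hae hab
  have : c ≠ d := by rintro rfl; exact hce hde
  have : c ≠ e := by rintro rfl; exact hcd hde.symm
  refine no_copy h ![a, b, c, d, e] ?_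
  intro i j hij
  fin_cases i <;> fin_cases j <;> simp at hij <;> simp [P3P2, *]

lemma forb_P2K3 (h : IsEmpty (P2K3 ↪g G)) (a b c d e : V)
    (hab : G.Adj a b) (hcd : G.Adj c d) (hde : G.Adj d e) (hce : G.Adj c e)
    (hac : ¬ G.Adj a c) (had : ¬ G.Adj a d) (hae : ¬ G.Adj a e) (hbc : ¬ G.Adj b c)
    (hbd : ¬ G.Adj b d) (hbe : ¬ G.Adj b e) : False := by
  have := hab.ne; have := hcd.ne; have := hde.ne; have := hce.ne
  have : a ≠ c := by rintro rfl; exact had hcd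
  have : a ≠ d := by rintro rfl; exact hae hde
  have : a ≠ e := by rintro rfl; exact had hde.symm
  have : b ≠ c := by rintro rfl; exact hbd hcd
  have : b ≠ d := by rintro rfl; exact hbe hde
  have : b ≠ e := by rintro rfl; exact hbd hde.symm
  refine no_copy h ![a, b, c, d, e] ?_
  intro i j hij
  fin_cases i <;> fin_cases j <;> simp at hij <;> simp [P2K3, *]

lemma forb_W4 (h : IsEmpty (W4 ↪g G)) (a b c d e : V)
    (hab : G.Adj a b) (hbc : G.Adj b c) (hcd : G.Adj c d) (had : G.Adj a d)
    (hae : G.Adj a e) (hbe : G.Adj b e) (hce : G.Adj c e) (hde : G.Adj d e)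
    (hac : ¬ G.Adj a c) (hbd : ¬ G.Adj b d) (nac : a ≠ c) (nbd : b ≠ d) : False := by
  have := hab.ne; have := hbc.ne; have := hcd.ne; have := had.ne
  have := hae.ne; have := hbe.ne; have := hce.ne; have := hde.ne
  refine no_copy h ![a, b, c, d, e] ?_
  intro i j hij
  fin_cases i <;> fin_cases j <;> simp at hij <;> simp [W4, *]

lemma forb_F1 (h : IsEmpty (F1 ↪g G)) (a b c d e f : V)
    (hab : G.Adj a b) (hbc : G.Adj b c) (hcd : G.Adj c d) (hde : G.Adj d e)
    (hef : G.Adj e f) (haf : G.Adj a f) (hbf : G.Adj b f) (hce : G.Adj c e)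
    (hac : ¬ G.Adj a c) (had : ¬ G.Adj a d) (hae : ¬ G.Adj a e)
    (hbd : ¬ G.Adj b d) (hbe : ¬ G.Adj b e) (hcf : ¬ G.Adj c f)
    (hdf : ¬ G.Adj d f) : False := by
  have := hab.ne; have := hbc.ne; have := hcd.ne; have := hde.ne
  have := hef.ne; have := haf.ne; have := hbf.ne; have := hce.ne
  have : a ≠ c := by rintro rfl; exact hcf haf
  have : a ≠ d := by rintro rfl; exact hdf haf
  have : a ≠ e := by rintro rfl; exact hbe hab.symm
  have : b ≠ d := by rintro rfl; exact had hab
  have : b ≠ e := by rintro rfl; exact hae hab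
  have : c ≠ f := by rintro rfl; exact hac haf
  have : d ≠ f := by rintro rfl; exact had haf
  refine no_copy h ![a, b, c, d, e, f] ?_
  intro i j hij
  fin_cases i <;> fin_cases j <;> simp at hij <;> simp [F1, *]

lemma forb_K4 (h : G.CliqueFree 4) (a b c d : V)
    (hab : G.Adj a b) (hac : G.Adj a c) (had : G.Adj a d)
    (hbc : G.Adj b c) (hbd : G.Adj b d) (hcd : G.Adj c d) : False := by
  classical
  refine h {a, b, c, d} ?_
  have := hab.ne; have := hac.ne; have := had.ne; have := hbc.ne; have := hbd.ne; have := hcd.ne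
  constructor
  · simp [IsClique, Set.Pairwise, *, G.adj_comm]
  · simp [*]

end forbidden

/-- The six colour classes, described through the adjacency pattern `A0, …, A5`
of a vertex to the fixed copy of `F2`. -/
def Zc (A0 A1 A3 A4 A5 : Prop) : Prop :=
  ¬ A0 ∧ ¬ A4 ∧ ¬ (A3 ∧ A5) ∧ ((A3 ∨ A5) → A1) ∧ (A1 → A3 ∨ A5)

def Wc (A0 A1 A2 A3 A5 : Prop) : Prop :=
  ¬ A1 ∧ ¬ A2 ∧ ¬ (A3 ∧ A5) ∧ ((A3 ∨ A5) → A0) ∧ (A0 → A3 ∨ A5)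

def Xc (A0 A1 A2 A3 A4 A5 : Prop) : Prop :=
  A0 ∧ ¬ A4 ∧ ((A2 ∧ A3 ∧ ¬ A1 ∧ ¬ A5) ∨ (A2 ∧ A5 ∧ ¬ A1 ∧ ¬ A3) ∨
    (A3 ∧ A5 ∧ ¬ A2))

def Yc (A0 A1 A2 A3 A4 A5 : Prop) : Prop :=
  A1 ∧ ¬ A0 ∧ ¬ A2 ∧ ((A3 ∧ A4 ∧ ¬ A5) ∨ (A4 ∧ A5 ∧ ¬ A3) ∨ (A3 ∧ A5 ∧ ¬ A4))

def Bc (A0 A1 A2 A4 : Prop) : Prop := ¬ A0 ∧ ¬ A1 ∧ A2 ∧ A4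

theorem stmt14 {V : Type*} [Fintype V] (G : SimpleGraph V)
    (hP : IsEmpty (P3P2 ↪g G)) (hW : IsEmpty (W4 ↪g G)) (hK4 : G.CliqueFree 4)
    (hP2K3 : IsEmpty (P2K3 ↪g G)) (hF1 : IsEmpty (F1 ↪g G))
    (hQ : Nonempty (F2 ↪g G)) :
    G.chromaticNumber ≤ 6 := by
  obtain ⟨φ⟩ := hQ
  have hφ : ∀ i j, G.Adj (φ i) (φ j) ↔ F2.Adj i j := fun i j => φ.map_rel_iff
  have h01 : G.Adj (φ 0) (φ 1) := (hφ 0 1).2 (by simp [F2])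
  have h12 : G.Adj (φ 1) (φ 2) := (hφ 1 2).2 (by simp [F2])
  have h23 : G.Adj (φ 2) (φ 3) := (hφ 2 3).2 (by simp [F2])
  have h34 : G.Adj (φ 3) (φ 4) := (hφ 3 4).2 (by simp [F2])
  have h04 : G.Adj (φ 0) (φ 4) := (hφ 0 4).2 (by simp [F2])
  have h25 : G.Adj (φ 2) (φ 5) := (hφ 2 5).2 (by simp [F2])
  have h35 : G.Adj (φ 3) (φ 5) := (hφ 3 5).2 (by simp [F2])
  have h45 : G.Adj (φ 4) (φ 5) := (hφ 4 5).2 (by simp [F2])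
  have h02 : ¬ G.Adj (φ 0) (φ 2) := mt (hφ 0 2).1 (by simp [F2])
  have h03 : ¬ G.Adj (φ 0) (φ 3) := mt (hφ 0 3).1 (by simp [F2])
  have h05 : ¬ G.Adj (φ 0) (φ 5) := mt (hφ 0 5).1 (by simp [F2])
  have h13 : ¬ G.Adj (φ 1) (φ 3) := mt (hφ 1 3).1 (by simp [F2])
  have h14 : ¬ G.Adj (φ 1) (φ 4) := mt (hφ 1 4).1 (by simp [F2])
  have h15 : ¬ G.Adj (φ 1) (φ 5) := mt (hφ 1 5).1 (by simp [F2])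
  have h24 : ¬ G.Adj (φ 2) (φ 4) := mt (hφ 2 4).1 (by simp [F2])
  have n24 : φ 2 ≠ φ 4 := fun h => by simpa using φ.injective h
  generalize φ 0 = f0 at *
  generalize φ 1 = f1 at *
  generalize φ 2 = f2 at *
  generalize φ 3 = f3 at *
  generalize φ 4 = f4 at *
  generalize φ 5 = f5 at *
  clear hφ
  have cm : ∀ x y, G.Adj x y ↔ G.Adj y x := G.adj_comm
  have hir : ∀ x, ¬ G.Adj x x := fun x => G.irrefl
  let Z : V → Prop := fun x => Zc (G.Adj f0 x) (G.Adj f1 x) (G.Adj f3 x) (G.Adj f4 x) (G.Adj f5 x)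
  let W : V → Prop := fun x => Wc (G.Adj f0 x) (G.Adj f1 x) (G.Adj f2 x) (G.Adj f3 x) (G.Adj f5 x) ∨ x = f1
  let X : V → Prop := fun x => Xc (G.Adj f0 x) (G.Adj f1 x) (G.Adj f2 x) (G.Adj f3 x) (G.Adj f4 x) (G.Adj f5 x)
  let Y : V → Prop := fun x => Yc (G.Adj f0 x) (G.Adj f1 x) (G.Adj f2 x) (G.Adj f3 x) (G.Adj f4 x) (G.Adj f5 x) ∨ x = f0
  let B : V → Prop := fun x => Bc (G.Adj f0 x) (G.Adj f1 x) (G.Adj f2 x) (G.Adj f4 x)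
  -- every vertex lies in one of the classes
  have cover : ∀ x, Z x ∨ W x ∨ X x ∨ Y x ∨ B x := by
    intro x
    simp only [Z, W, X, Y, B, Zc, Wc, Xc, Yc, Bc]
    by_cases e0 : x = f0
    · simp [e0]
    by_cases e1 : x = f1
    · simp [e1]
    by_cases e2 : x = f2
    · grind
    by_cases e3 : x = f3
    · grind
    by_cases e4 : x = f4
    · grind
    by_cases e5 : x = f5
    · grind
    have k1 := forb_K4 hK4 f2 f3 f5 x
    have k2 := forb_K4 hK4 f3 f4 f5 x
    have k3 := forb_P3P2 hP f0 f1 x f3 f5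
    have k4 := forb_P3P2 hP f1 f0 x f3 f5
    have k5 := forb_P3P2 hP f3 f5 x f0 f1
    have k6 := forb_P3P2 hP f5 f3 x f0 f1
    have k7 := forb_P2K3 hP2K3 f3 f5 f0 f1 x
    have k8 := forb_W4 hW f2 f3 f4 x f5
    have k9 := forb_W4 hW f2 f5 f4 x f3
    have k10 := forb_F1 hF1 f0 f1 f2 f3 f5 x
    have k11 := forb_F1 hF1 f0 f1 f2 f5 f3 x
    have k12 := forb_P2K3 hP2K3 f0 f1 f3 f5 x
    have k13 := forb_F1 hF1 f1 f0 f4 f3 f5 x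
    have k14 := forb_F1 hF1 f1 f0 f4 f5 f3 x
    clear hP hW hK4 hP2K3 hF1
    grind (splits := 40)
  -- the classes `Z`, `W`, `X`, `Y` are stable
  have sZ : ∀ x y, Z x → Z y → ¬ G.Adj x y := by
    intro x y hx hy hxy
    simp only [Z, Zc] at hx hy
    have k1 := forb_P3P2 hP f0 f4 f3 x y
    have k2 := forb_P3P2 hP f0 f4 f5 x y
    have k3 := forb_F1 hF1 f1 x f3 f4 f5 y
    have k4 := forb_F1 hF1 f1 y f3 f4 f5 x
    clear hP hW hK4 hP2K3 hF1 cover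
    grind (splits := 40)
  have sW : ∀ x y, W x → W y → ¬ G.Adj x y := by
    intro x y hx hy hxy
    simp only [W, Wc] at hx hy
    have k1 := forb_P3P2 hP f1 f2 f3 x y
    have k2 := forb_P3P2 hP f1 f2 f5 x y
    have k3 := forb_F1 hF1 f0 x f3 f2 f5 y
    have k4 := forb_F1 hF1 f0 y f3 f2 f5 x
    clear hP hW hK4 hP2K3 hF1 cover
    grind (splits := 40)
  have sX : ∀ x y, X x → X y → ¬ G.Adj x y := by
    intro x y hx hy hxy
    simp only [X, Xc] at hx hy
    have nx2 : f2 ≠ x := fun h => h02 (h ▸ hx.1)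
    have ny2 : f2 ≠ y := fun h => h02 (h ▸ hy.1)
    have nx3 : f3 ≠ x := fun h => h03 (h ▸ hx.1)
    have ny3 : f3 ≠ y := fun h => h03 (h ▸ hy.1)
    have nx5 : f5 ≠ x := fun h => h05 (h ▸ hx.1)
    have ny5 : f5 ≠ y := fun h => h05 (h ▸ hy.1)
    have k1 := forb_K4 hK4 f2 f3 x y
    have k2 := forb_K4 hK4 f2 f5 x y
    have k3 := forb_K4 hK4 f3 f5 x y
    have k4 := forb_W4 hW f2 f3 x y f5
    have k5 := forb_W4 hW f2 f3 y x f5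
    have k6 := forb_W4 hW f2 f5 x y f3
    have k7 := forb_W4 hW f2 f5 y x f3
    have k8 := forb_W4 hW f3 f5 x y f2
    have k9 := forb_W4 hW f3 f5 y x f2
    clear hP hW hK4 hP2K3 hF1 cover
    grind (splits := 40)
  have sY : ∀ x y, Y x → Y y → ¬ G.Adj x y := by
    intro x y hx hy hxy
    simp only [Y, Yc] at hx hy
    rcases hx with hx | hx
    swap
    · grind
    rcases hy with hy | hy
    swap
    · grind
    have nx3 : f3 ≠ x := fun h => h13 (h ▸ hx.1)
    have ny3 : f3 ≠ y := fun h => h13 (h ▸ hy.1)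
    have nx4 : f4 ≠ x := fun h => h14 (h ▸ hx.1)
    have ny4 : f4 ≠ y := fun h => h14 (h ▸ hy.1)
    have nx5 : f5 ≠ x := fun h => h15 (h ▸ hx.1)
    have ny5 : f5 ≠ y := fun h => h15 (h ▸ hy.1)
    have k1 := forb_K4 hK4 f3 f4 x y
    have k2 := forb_K4 hK4 f3 f5 x y
    have k3 := forb_K4 hK4 f4 f5 x y
    have k4 := forb_W4 hW f3 f4 x y f5
    have k5 := forb_W4 hW f3 f4 y x f5
    have k6 := forb_W4 hW f3 f5 x y f4
    have k7 := forb_W4 hW f3 f5 y x f4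
    have k8 := forb_W4 hW f4 f5 x y f3
    have k9 := forb_W4 hW f4 f5 y x f3
    clear hP hW hK4 hP2K3 hF1 cover
    grind (splits := 40)
  -- the class `B` induces a matching
  have mB : ∀ x y z, B x → B y → B z → G.Adj x y → G.Adj y z → x = z := by
    intro x y z hx hy hz hxy hyz
    simp only [B, Bc] at hx hy hz
    by_contra hne
    by_cases hxz : G.Adj x z
    · exact forb_P2K3 hP2K3 f0 f1 x y z h01 hxy hyz hxz hx.1 hy.1 hz.1 hx.2.1 hy.2.1 hz.2.1
    · exact forb_P3P2 hP x y z f0 f1 hxy hyz h01 hxz (fun h => hx.1 h.symm)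
        (fun h => hx.2.1 h.symm) (fun h => hy.1 h.symm) (fun h => hy.2.1 h.symm)
        (fun h => hz.1 h.symm) (fun h => hz.2.1 h.symm) hne
  let r : V → Fin (Fintype.card V) := Fintype.equivFin V
  have hr : Function.Injective r := (Fintype.equivFin V).injective
  let L : V → Prop := fun x => ∃ y, B y ∧ G.Adj y x ∧ r y < r x
  let C : Fin 6 → V → Prop :=
    ![Z, W, X, Y, fun x => B x ∧ L x, fun x => B x ∧ ¬ L x]
  have hC : ∀ x, ∃ i, C i x := by
    intro x
    rcases cover x with h | h | h | h | h
    · exact ⟨0, h⟩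
    · exact ⟨1, h⟩
    · exact ⟨2, h⟩
    · exact ⟨3, h⟩
    · by_cases hl : L x
      · exact ⟨4, h, hl⟩
      · exact ⟨5, h, hl⟩
  have sB : ∀ x y, B x → B y → G.Adj x y → r x < r y → (L x ↔ L y) → False := by
    intro x y hx hy hxy hlt hl
    obtain ⟨z, hz, hzx, hzr⟩ := hl.2 ⟨x, hx, hxy, hlt⟩
    have := mB z x y hz hx hy hzx hxy
    subst this
    exact absurd hzr hlt.asymm
  have sB2 : ∀ x y, B x → B y → (L x ↔ L y) → ¬ G.Adj x y := by
    intro x y hx hy hl hxy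
    rcases lt_trichotomy (r x) (r y) with h | h | h
    · exact sB x y hx hy hxy h hl
    · exact hxy.ne (hr h)
    · exact sB y x hy hx hxy.symm h hl.symm
  have sC : ∀ i x y, C i x → C i y → ¬ G.Adj x y := by
    intro i x y hx hy
    fin_cases i
    · exact sZ x y hx hy
    · exact sW x y hx hy
    · exact sX x y hx hy
    · exact sY x y hx hy
    · exact sB2 x y hx.1 hy.1 (iff_of_true hx.2 hy.2)
    · exact sB2 x y hx.1 hy.1 (iff_of_false hx.2 hy.2)
  choose c hc using hC
  have hcol : G.Colorable 6 :=
    ⟨Coloring.mk c fun {x y} hxy he => sC (c x) x y (hc x) (he ▸ hc y) hxy⟩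
  exact_mod_cast hcol.chromaticNumber_le
end
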